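/- arXiv:2109.09651 — 2 statements merged into one kernel-verified Lean document; each statement's English description precedes it below -/
import Mathlib

section
/- With b : ℝ → ℝ bounded, ≥ m > 0, equal to b₊ for s > M and b₋ for s < -M, the n-th eigenvalue ν_n(k) of the operator O_b(k) = -d²/dx² + (∫₀^x b(t)dt - k)² satisfies ν_n(k) ≥ m(n + 1/2) for every k ∈ ℝ and every n ∈ ℕ. -/
open MeasureTheory Filter

/-- The primitive `∫₀ˣ b` of the magnetic intensity. -/
noncomputable def prim (b : ℝ → ℝ) (x : ℝ) : ℝ := ∫ t in (0:ℝ)..x, b t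

/-- The potential `(∫₀ˣ b - k)²` of the fibered operator `O_b(k)`. -/
noncomputable def pot (b : ℝ → ℝ) (k x : ℝ) : ℝ := (prim b x - k) ^ 2

/-- `H` is an `L²` eigenfunction of `O_b(k) = -d²/dx² + (∫₀ˣ b - k)²` with eigenvalue `μ`. -/
def IsEigenpair (b : ℝ → ℝ) (k μ : ℝ) (H : ℝ → ℝ) : Prop :=
  ContDiff ℝ 1 H ∧ Differentiable ℝ (deriv H) ∧
  Integrable (fun x => (H x) ^ 2) ∧ H ≠ 0 ∧
  ∀ x, -(deriv (deriv H) x) + pot b k x * H x = μ * H x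

/-- `ν` enumerates, strictly increasingly, all the eigenvalues of `O_b(k)`. -/
def IsEigList (b : ℝ → ℝ) (k : ℝ) (ν : ℕ → ℝ) : Prop :=
  StrictMono ν ∧ (∀ n, ∃ H, IsEigenpair b k (ν n) H) ∧
  (∀ μ H, IsEigenpair b k μ H → ∃ n, μ = ν n)

/-- The standing assumptions on the magnetic intensity `b`: measurable, bounded,
`b ≥ m > 0` a.e., and equal to the constants `b₊` (for `s > M`) resp. `b₋` (for `s < -M`). -/
def Bfield (b : ℝ → ℝ) (m bp bm M : ℝ) : Prop :=
  Measurable b ∧ (∃ C, ∀ s, |b s| ≤ C) ∧ 0 < m ∧ (∀ᵐ s : ℝ, m ≤ b s) ∧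
  0 < bp ∧ 0 < bm ∧ 0 < M ∧
  (∀ s, M < s → b s = bp) ∧ (∀ s, s < -M → b s = bm)

open Set Topology
structure SolT (q u v : ℝ → ℝ) : Prop where
  du : ∀ x, HasDerivAt u (v x) x
  dv : ∀ x, HasDerivAt v (q x * u x) x
  lim : Tendsto u atTop (𝓝 0)
  bd : ∃ C, ∀ᶠ x in atTop, |v x| ≤ C

def Sol (q u v : ℝ → ℝ) : Prop :=
  SolT q u v ∧ SolT (fun x => q (-x)) (fun x => u (-x)) (fun x => - v (-x))

lemma SolT.neg {q u v : ℝ → ℝ} (h : SolT q u v) : SolT q (fun x => - u x) (fun x => - v x) where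
  du x := (h.du x).neg
  dv x := (h.dv x).neg.congr_deriv (by ring)
  lim := by simpa using h.lim.neg
  bd := by simpa using h.bd

lemma Sol.neg {q u v : ℝ → ℝ} (h : Sol q u v) : Sol q (fun x => - u x) (fun x => - v x) :=
  ⟨h.1.neg, h.2.neg⟩

lemma not_int {f : ℝ → ℝ} (hf : Integrable f) {a ε : ℝ} (he : 0 < ε) (h : ∀ x, a ≤ x → ε ≤ f x) :
    False := by
  have h1 : IntegrableOn (fun _ : ℝ => ε) (Ici a) := by
    refine Integrable.mono' (hf.integrableOn (s := Ici a)) aestronglyMeasurable_const ?_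
    filter_upwards [ae_restrict_mem measurableSet_Ici] with x hx
    rw [Real.norm_of_nonneg he.le]; exact h x hx
  rw [integrableOn_const_iff (by simp)] at h1
  simp [he.ne'] at h1

lemma decay {q u v : ℝ → ℝ} (du : ∀ x, HasDerivAt u (v x) x)
    (dv : ∀ x, HasDerivAt v (q x * u x) x) (hi : Integrable (fun x => (u x)^2))
    {R : ℝ} (hq : ∀ x, R ≤ x → 0 ≤ q x) : SolT q u v := by
  have dg : ∀ x, HasDerivAt (fun x => u x * v x) (v x * v x + u x * (q x * u x)) x :=
    fun x => (du x).mul (dv x)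
  have df : ∀ x, HasDerivAt (fun x => u x ^ 2) (2 * (u x * v x)) x := fun x =>
    ((du x).pow 2).congr_deriv (by push_cast; ring)
  have de : ∀ x, HasDerivAt (fun x => v x ^ 2) (2 * q x * (u x * v x)) x := fun x =>
    ((dv x).pow 2).congr_deriv (by push_cast; ring)
  have gm : MonotoneOn (fun x => u x * v x) (Ici R) := by
    apply monotoneOn_of_deriv_nonneg (convex_Ici R)
    · exact fun x _ => (dg x).continuousAt.continuousWithinAt
    · exact fun x _ => (dg x).differentiableAt.differentiableWithinAt
    · intro x hx
      rw [interior_Ici] at hx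
      rw [(dg x).deriv]
      have := hq x (le_of_lt hx)
      nlinarith [mul_self_nonneg (v x), mul_nonneg this (mul_self_nonneg (u x))]
  have gneg : ∀ x, R ≤ x → u x * v x ≤ 0 := by
    intro x1 hx1
    by_contra! hc
    have fm : MonotoneOn (fun x => u x ^ 2) (Ici x1) := by
      apply monotoneOn_of_deriv_nonneg (convex_Ici x1)
      · exact fun x _ => (df x).continuousAt.continuousWithinAt
      · exact fun x _ => (df x).differentiableAt.differentiableWithinAt
      · intro x hx
        rw [interior_Ici] at hx
        rw [(df x).deriv]
        have : u x1 * v x1 ≤ u x * v x := gm hx1 (hx1.trans (le_of_lt hx)) (le_of_lt hx)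
        linarith
    have hu : u x1 ≠ 0 := by rintro h; simp [h] at hc
    exact not_int hi (a := x1) (ε := u x1 ^ 2) (by positivity)
      (fun x hx => fm self_mem_Ici hx hx)
  have fa : AntitoneOn (fun x => u x ^ 2) (Ici R) := by
    apply antitoneOn_of_deriv_nonpos (convex_Ici R)
    · exact fun x _ => (df x).continuousAt.continuousWithinAt
    · exact fun x _ => (df x).differentiableAt.differentiableWithinAt
    · intro x hx
      rw [interior_Ici] at hx
      rw [(df x).deriv]
      linarith [gneg x (le_of_lt hx)]
  have ea : AntitoneOn (fun x => v x ^ 2) (Ici R) := by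
    apply antitoneOn_of_deriv_nonpos (convex_Ici R)
    · exact fun x _ => (de x).continuousAt.continuousWithinAt
    · exact fun x _ => (de x).differentiableAt.differentiableWithinAt
    · intro x hx
      rw [interior_Ici] at hx
      rw [(de x).deriv]
      nlinarith [gneg x (le_of_lt hx), hq x (le_of_lt hx)]
  refine ⟨du, dv, ?_, |v R|, ?_⟩
  · rw [Metric.tendsto_atTop]
    intro ε he
    obtain ⟨x1, h1, h2⟩ : ∃ x1, R ≤ x1 ∧ u x1 ^ 2 < ε ^ 2 := by
      by_contra! hc
      exact not_int hi (a := R) (ε := ε ^ 2) (by positivity) hc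
    refine ⟨x1, fun x hx => ?_⟩
    have : u x ^ 2 ≤ u x1 ^ 2 := fa h1 (h1.trans hx) hx
    rw [Real.dist_eq, sub_zero]
    exact abs_lt_of_sq_lt_sq (this.trans_lt h2) he.le
  · filter_upwards [eventually_ge_atTop R] with x hx
    exact sq_le_sq.mp (ea self_mem_Ici hx hx)

lemma decay_both {q u v : ℝ → ℝ} (du : ∀ x, HasDerivAt u (v x) x)
    (dv : ∀ x, HasDerivAt v (q x * u x) x) (hi : Integrable (fun x => (u x)^2))
    {R : ℝ} (hq : ∀ x, R ≤ |x| → 0 ≤ q x) : Sol q u v := by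
  refine ⟨decay du dv hi (R := R) fun x hx => hq x (hx.trans (le_abs_self x)), ?_⟩
  refine decay (R := R) ?_ ?_ ?_ ?_
  · intro x
    have := (du (-x)).comp x (hasDerivAt_neg x)
    simpa [Function.comp_def] using this
  · intro x
    exact ((dv (-x)).comp x (hasDerivAt_neg x)).neg.congr_deriv (by ring)
  · exact hi.comp_neg
  · intro x hx
    exact hq _ (by rw [abs_neg]; exact hx.trans (le_abs_self x))

lemma right_end {q u v p w z : ℝ → ℝ} (hu : SolT q u v) (hw : SolT p w z) (hqp : ∀ x, p x < q x)
    (c : ℝ) (b : EReal) (hcb : (c : EReal) < b) (hb : ∀ x : ℝ, b = x → u x = 0)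
    (huc : 0 < u c) (hwp : ∀ x : ℝ, c ≤ x → (x : EReal) < b → 0 < w x) :
    v c * w c - u c * z c < 0 := by
  have dW : ∀ x, HasDerivAt (fun x => v x * w x - u x * z x) ((q x - p x) * (u x * w x)) x := by
    intro x
    exact (((hu.dv x).mul (hw.du x)).sub ((hu.du x).mul (hw.dv x))).congr_deriv (by ring)
  have uc : Continuous u := continuous_iff_continuousAt.2 fun x => (hu.du x).continuousAt
  have wc : Continuous w := continuous_iff_continuousAt.2 fun x => (hw.du x).continuousAt
  have pos_of : ∀ y, c ≤ y → (∀ x, c ≤ x → x < y → u x ≠ 0) → ∀ x, c ≤ x → x < y → 0 < u x := by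
    intro y hy h x hx hxy
    by_contra! hn
    obtain ⟨t, ht, ht0⟩ := intermediate_value_Icc' hx uc.continuousOn ⟨hn, huc.le⟩
    exact h t ht.1 (ht.2.trans_lt hxy) ht0
  by_cases hz : ∃ x, c ≤ x ∧ u x = 0 ∧ (x : EReal) ≤ b
  · obtain ⟨x1, hx1, hx1z, hx1b⟩ := hz
    set S := {x | c ≤ x ∧ u x = 0} with hS
    have hSc : IsClosed S := isClosed_Ici.inter (isClosed_singleton.preimage uc)
    have hSb : BddBelow S := ⟨c, fun x hx => hx.1⟩
    have hmem : sInf S ∈ S := hSc.csInf_mem ⟨x1, hx1, hx1z⟩ hSb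
    set d := sInf S with hd
    have hdb : (d : EReal) ≤ b :=
      le_trans (EReal.coe_le_coe_iff.2 (csInf_le hSb ⟨hx1, hx1z⟩)) hx1b
    have hcd : c < d := lt_of_le_of_ne hmem.1 (by rintro h; rw [h, hmem.2] at huc; exact lt_irrefl _ huc)
    have hup := pos_of d hcd.le (fun x hx hxd h0 => absurd (csInf_le hSb ⟨hx, h0⟩) (not_le.2 hxd))
    have hwp' : ∀ x, c ≤ x → x < d → 0 < w x := fun x hx hxd =>
      hwp x hx (lt_of_lt_of_le (EReal.coe_lt_coe_iff.2 hxd) hdb)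
    have mono : StrictMonoOn (fun x => v x * w x - u x * z x) (Icc c d) := by
      apply strictMonoOn_of_deriv_pos (convex_Icc c d)
      · exact fun x _ => (dW x).continuousAt.continuousWithinAt
      · intro x hx
        rw [interior_Icc] at hx
        rw [(dW x).deriv]
        exact mul_pos (sub_pos.2 (hqp x)) (mul_pos (hup x hx.1.le hx.2) (hwp' x hx.1.le hx.2))
    have h1 := mono (left_mem_Icc.2 hcd.le) (right_mem_Icc.2 hcd.le) hcd
    have hwd : 0 ≤ w d := by
      refine ge_of_tendsto (wc.continuousWithinAt (s := Iio d)).tendsto ?_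
      filter_upwards [Ioo_mem_nhdsLT hcd] with x hx
      exact (hwp' x hx.1.le hx.2).le
    have hvd : v d ≤ 0 := by
      have := (hasDerivAt_iff_tendsto_slope.1 (hu.du d)).mono_left (nhdsLT_le_nhdsNE d)
      refine le_of_tendsto this ?_
      filter_upwards [Ioo_mem_nhdsLT hcd] with x hx
      rw [slope_def_field, hmem.2]
      exact div_nonpos_of_nonneg_of_nonpos (by linarith [hup x hx.1.le hx.2]) (by linarith [hx.2])
        |> fun h => h
    have h2 := hmem.2
    simp only [h2] at h1
    nlinarith
  · push Not at hz
    have hbt : b = ⊤ := by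
      induction b with
      | bot => simp at hcb
      | top => rfl
      | coe b => exact absurd le_rfl (not_le.2 (hz b (EReal.coe_le_coe_iff.1 hcb.le) (hb b rfl)))
    subst hbt
    have hup : ∀ x, c ≤ x → 0 < u x := fun x hx =>
      pos_of (x+1) (by linarith) (fun y hy _ h0 => absurd le_top (not_le.2 (hz y hy h0))) x hx (by linarith)
    have mono : StrictMonoOn (fun x => v x * w x - u x * z x) (Ici c) := by
      apply strictMonoOn_of_deriv_pos (convex_Ici c)
      · exact fun x _ => (dW x).continuousAt.continuousWithinAt
      · intro x hx
        rw [interior_Ici] at hx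
        have hx' : c ≤ x := le_of_lt hx
        rw [(dW x).deriv]
        exact mul_pos (sub_pos.2 (hqp x)) (mul_pos (hup x hx') (hwp x hx' (EReal.coe_lt_top x)))
    have lim : Tendsto (fun x => v x * w x - u x * z x) atTop (𝓝 0) := by
      obtain ⟨C, hC⟩ := hu.bd
      obtain ⟨D, hD⟩ := hw.bd
      have l1 : Tendsto (fun x => v x * w x) atTop (𝓝 0) :=
        bdd_le_mul_tendsto_zero' C hC hw.lim
      have l2 : Tendsto (fun x => z x * u x) atTop (𝓝 0) :=
        bdd_le_mul_tendsto_zero' D hD hu.lim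
      simpa [mul_comm] using l1.sub l2
    have h1 := mono (self_mem_Ici) (show c + 1 ∈ Ici c by simp) (by linarith)
    have h2 : v (c+1) * w (c+1) - u (c+1) * z (c+1) ≤ 0 := by
      refine ge_of_tendsto lim ?_
      filter_upwards [eventually_ge_atTop (c+1)] with x hx
      exact mono.monotoneOn (show c + 1 ∈ Ici c by simp) (show c ≤ x by linarith) hx
    exact h1.trans_le h2

lemma compare_pos {q u v p w z : ℝ → ℝ} (hu : Sol q u v) (hw : Sol p w z) (hqp : ∀ x, p x < q x)
    (c : ℝ) (a b : EReal) (hac : a < c) (hcb : (c : EReal) < b)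
    (ha : ∀ x : ℝ, a = x → u x = 0) (hb : ∀ x : ℝ, b = x → u x = 0)
    (huc : 0 < u c) (hwp : ∀ x : ℝ, a < x → (x : EReal) < b → 0 < w x) : False := by
  have h1 := right_end hu.1 hw.1 hqp c b hcb hb huc
    (fun x hx hxb => hwp x (hac.trans_le (EReal.coe_le_coe_iff.2 hx)) hxb)
  have h2 := right_end hu.2 hw.2 (fun x => hqp (-x)) (-c) (-a)
    (by rw [EReal.coe_neg]; exact EReal.neg_lt_neg_iff.2 hac)
    (fun x hx => ha (-x) (by rw [EReal.coe_neg, ← hx, neg_neg])) (by simpa using huc)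
    (fun x hx hxa => hwp (-x) (by rw [EReal.coe_neg]; exact EReal.lt_neg_comm.1 hxa)
      (lt_of_le_of_lt (EReal.coe_le_coe_iff.2 (by linarith)) hcb))
  simp only [neg_neg] at h2
  linarith

lemma compare {q u v p w z : ℝ → ℝ} (hu : Sol q u v) (hw : Sol p w z) (hqp : ∀ x, p x < q x)
    (hnz : ∀ s t : ℝ, s < t → ∃ c ∈ Ioo s t, u c ≠ 0)
    (a b : EReal) (hab : a < b)
    (ha : ∀ x : ℝ, a = x → u x = 0) (hb : ∀ x : ℝ, b = x → u x = 0) :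
    ∃ x : ℝ, a < x ∧ (x : EReal) < b ∧ w x = 0 := by
  by_contra! hc
  obtain ⟨c, hac, hcb, huc⟩ : ∃ c : ℝ, a < c ∧ (c : EReal) < b ∧ u c ≠ 0 := by
    obtain ⟨s, has, hsb⟩ := EReal.lt_iff_exists_real_btwn.1 hab
    obtain ⟨t, hst, htb⟩ := EReal.lt_iff_exists_real_btwn.1 hsb
    obtain ⟨c, hc, h⟩ := hnz s t (EReal.coe_lt_coe_iff.1 hst)
    exact ⟨c, has.trans (EReal.coe_lt_coe_iff.2 hc.1), (EReal.coe_lt_coe_iff.2 hc.2).trans htb, h⟩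
  have wc : Continuous w := continuous_iff_continuousAt.2 fun x => (hw.1.du x).continuousAt
  have key : ∀ {w z : ℝ → ℝ}, Sol p w z → Continuous w →
      (∀ x : ℝ, a < x → (x : EReal) < b → w x ≠ 0) → 0 < w c → False := by
    intro w z hw wc hc hwc
    have hwp : ∀ x : ℝ, a < x → (x : EReal) < b → 0 < w x := by
      intro x hax hxb
      by_contra! hn
      have hs : Icc (w x) (w c) ⊆ w '' uIcc x c := by
        refine subset_trans ?_ (intermediate_value_uIcc wc.continuousOn)
        exact Icc_subset_uIcc
      obtain ⟨t, ht, ht0⟩ := hs ⟨hn, hwc.le⟩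
      rw [uIcc, mem_Icc] at ht
      refine hc t (lt_of_lt_of_le ?_ (EReal.coe_le_coe_iff.2 ht.1))
        (lt_of_le_of_lt (EReal.coe_le_coe_iff.2 ht.2) ?_) ht0
      · rcases min_choice x c with h | h <;> rw [h] <;> assumption
      · rcases max_choice x c with h | h <;> rw [h] <;> assumption
    rcases lt_or_gt_of_ne huc with h | h
    · exact compare_pos hu.neg hw hqp c a b hac hcb (fun x hx => by simp [ha x hx])
        (fun x hx => by simp [hb x hx]) (by simpa using h) hwp
    · exact compare_pos hu hw hqp c a b hac hcb ha hb h hwp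
  rcases lt_or_gt_of_ne (hc c hac hcb) with h | h
  · exact key hw.neg wc.neg (fun x h1 h2 => neg_ne_zero.2 (hc x h1 h2)) (by simpa using h)
  · exact key hw wc hc h

def Chain (n : ℕ) (u : ℝ → ℝ) : Prop :=
  ∃ Z : ℕ → EReal, Z 0 = ⊥ ∧ Z (n+1) = ⊤ ∧ (∀ i ≤ n, Z i < Z (i+1)) ∧
    ∀ i ≤ n + 1, ∀ x : ℝ, Z i = x → u x = 0

lemma chain_zeros {n : ℕ} {q u v p w z : ℝ → ℝ} (hu : Sol q u v) (hw : Sol p w z)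
    (hqp : ∀ x, p x < q x)
    (hnz : ∀ s t : ℝ, s < t → ∃ c ∈ Ioo s t, u c ≠ 0) (h : Chain n u) :
    ∃ y : ℕ → ℝ, (∀ i < n, y i < y (i+1)) ∧ ∀ i ≤ n, w (y i) = 0 := by
  obtain ⟨Z, h0, h1, h2, h3⟩ := h
  have : ∀ i, ∃ x : ℝ, i ≤ n → Z i < x ∧ (x : EReal) < Z (i+1) ∧ w x = 0 := by
    intro i
    by_cases hi : i ≤ n
    · obtain ⟨x, hx⟩ := compare hu hw hqp hnz (Z i) (Z (i+1)) (h2 i hi) (h3 i (by omega))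
        (h3 (i+1) (by omega))
      exact ⟨x, fun _ => hx⟩
    · exact ⟨0, fun h => absurd h hi⟩
  choose y hy using this
  exact ⟨y, fun i hi => EReal.coe_lt_coe_iff.1 ((hy i hi.le).2.1.trans (hy (i+1) hi).1),
    fun i hi => (hy i hi).2.2⟩

lemma chain_of_zeros {n : ℕ} {w : ℝ → ℝ} (y : ℕ → ℝ) (h : ∀ i < n, y i < y (i+1))
    (h' : ∀ i ≤ n, w (y i) = 0) : Chain (n+1) w := by
  refine ⟨fun i => if i = 0 then ⊥ else if i ≤ n + 1 then (y (i-1) : EReal) else ⊤, by simp,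
    by simp, ?_, ?_⟩
  · intro i hi
    rcases i with _ | i
    · simp [EReal.bot_lt_coe]
    · by_cases h2 : i + 1 ≤ n
      · have := h i (by omega)
        simpa [show i ≤ n by omega, show i + 1 ≤ n from h2] using this
      · simp [show i ≤ n by omega, show ¬ (i + 1 ≤ n) from h2, EReal.coe_lt_top]
  · intro i hi x hx
    rcases i with _ | i
    · simp at hx
    · by_cases h2 : i ≤ n
      · simp only [Nat.add_eq_zero_iff, one_ne_zero, and_false, if_false, add_le_add_iff_right, h2,
          if_true, add_tsub_cancel_right, EReal.coe_eq_coe_iff] at hx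
        rw [← hx]; exact h' i h2
      · simp [h2] at hx

lemma chain_zero (u : ℝ → ℝ) : Chain 0 u := by
  refine ⟨fun i => if i = 0 then ⊥ else ⊤, by simp, by simp, ?_, ?_⟩
  · intro i hi
    have : i = 0 := by omega
    simp [this]
  · intro i hi x hx
    by_cases h : i = 0 <;> simp [h] at hx

lemma ode_nz {q u v : ℝ → ℝ} (hq : Continuous q) (du : ∀ x, HasDerivAt u (v x) x)
    (dv : ∀ x, HasDerivAt v (q x * u x) x) (hne : u ≠ 0) :
    ∀ s t : ℝ, s < t → ∃ c ∈ Ioo s t, u c ≠ 0 := by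
  intro s t hst
  by_contra! hc
  obtain ⟨x0, hx0⟩ := exists_between hst
  have hu0 : u x0 = 0 := hc x0 hx0
  have hv0 : v x0 = 0 := by
    have h1 : u =ᶠ[𝓝 x0] fun _ => 0 := by
      filter_upwards [Ioo_mem_nhds hx0.1 hx0.2] with x hx using hc x hx
    exact (du x0).unique ((hasDerivAt_const x0 (0:ℝ)).congr_of_eventuallyEq h1)
  apply hne
  funext x
  set a := min x x0 - 1
  set b := max x x0 + 1
  obtain ⟨K, hK⟩ := isCompact_Icc.exists_bound_of_continuousOn (s := Icc a b) hq.continuousOn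
  have hK0 : ∀ r ∈ Ioo a b, |q r| ≤ max K 1 := fun r hr =>
    (hK r (Ioo_subset_Icc_self hr)).trans (le_max_left _ _)
  have key := ODE_solution_unique_of_mem_Ioo (K := ⟨max K 1, by positivity⟩)
    (v := fun r (y : ℝ × ℝ) => (y.2, q r * y.1)) (s := fun _ => univ) (a := a) (b := b) (t₀ := x0)
    (f := fun r => (u r, v r)) (g := fun _ => (0, 0)) ?_ ?_ ?_ ?_ ?_
  · have hx : x ∈ Ioo a b :=
      ⟨by have := min_le_left x x0; simp only [a]; linarith, by
        have := le_max_left x x0; simp only [b]; linarith⟩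
    exact congrArg Prod.fst (key hx)
  · intro r hr
    apply LipschitzOnWith.of_dist_le_mul
    intro y _ y' _
    rw [Prod.dist_eq, Prod.dist_eq]
    simp only [Real.dist_eq, NNReal.coe_mk]
    have h1 := hK0 r hr
    have h2 : (1:ℝ) ≤ max K 1 := le_max_right _ _
    apply max_le
    · calc |y.2 - y'.2| ≤ max |y.1 - y'.1| |y.2 - y'.2| := le_max_right _ _
        _ ≤ _ := le_mul_of_one_le_left (by positivity) h2
    · rw [← mul_sub, abs_mul]
      exact mul_le_mul h1 (le_max_left _ _) (abs_nonneg _) (by positivity)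
  · exact ⟨by have := min_le_right x x0; simp only [a]; linarith, by
        have := le_max_right x x0; simp only [b]; linarith⟩
  · exact fun r _ => ⟨(du r).prodMk (dv r), trivial⟩
  · intro r _
    refine ⟨?_, trivial⟩
    exact (hasDerivAt_const r ((0:ℝ),(0:ℝ))).congr_deriv (by simp; rfl)
  · simp [hu0, hv0]

open Polynomial in
lemma hermite_ode (n : ℕ) :
    derivative (derivative (hermite n)) - X * derivative (hermite n) + (n : ℤ[X]) * hermite n = 0 := by
  induction n with
  | zero => simp
  | succ n ih =>
    have h1 : derivative (hermite (n+1)) = ((n:ℤ[X]) + 1) * hermite n := by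
      rw [hermite_succ]
      simp only [derivative_sub, derivative_mul, derivative_X, one_mul]
      linear_combination -ih
    rw [h1]
    simp only [derivative_mul, derivative_add, derivative_natCast, derivative_one]
    rw [hermite_succ]
    push_cast
    ring

lemma poly_gauss (P : Polynomial ℝ) :
    Tendsto (fun y : ℝ => P.eval y * Real.exp (-(1/4) * y^2)) (cocompact ℝ) (𝓝 0) := by
  induction P using Polynomial.induction_on' with
  | add p q hp hq => simpa [add_mul] using hp.add hq
  | monomial n a =>
    have := tendsto_rpow_abs_mul_exp_neg_mul_sq_cocompact (a := 1/4) (by norm_num) (n : ℝ)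
    have h2 : Tendsto (fun y : ℝ => y ^ n * Real.exp (-(1/4) * y^2)) (cocompact ℝ) (𝓝 0) := by
      rw [tendsto_zero_iff_abs_tendsto_zero]
      refine this.congr fun y => ?_
      simp [abs_mul]
    simpa [mul_assoc] using h2.const_mul a

lemma hermite_sol (m x0 : ℝ) (hm : 0 < m) (n : ℕ) :
    ∃ w z P, Sol (fun x => m^2 * (x - x0)^2 - m * (2 * n + 1)) w z ∧
      (P : Polynomial ℝ).natDegree ≤ n ∧ P ≠ 0 ∧ ∀ x, w x = 0 → P.eval (Real.sqrt (2*m) * (x - x0)) = 0 := by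
  set s := Real.sqrt (2*m) with hs
  have hs2 : s ^ 2 = 2 * m := Real.sq_sqrt (by positivity)
  have hs0 : 0 < s := Real.sqrt_pos.2 (by positivity)
  set P : Polynomial ℝ := (Polynomial.hermite n).map (Int.castRingHom ℝ) with hP
  have ode : P.derivative.derivative - Polynomial.X * P.derivative + (n : Polynomial ℝ) * P = 0 := by
    have := congrArg (Polynomial.map (Int.castRingHom ℝ)) (hermite_ode n)
    simpa [Polynomial.derivative_map, hP] using this
  have ode' : ∀ y, P.derivative.derivative.eval y - y * P.derivative.eval y + n * P.eval y = 0 := by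
    intro y
    simpa using congrArg (Polynomial.eval y) ode
  set Q : Polynomial ℝ := Polynomial.C s * (P.derivative - Polynomial.C (1/2) * Polynomial.X * P) with hQ
  have aff : ∀ x, HasDerivAt (fun x => s * (x - x0)) s x := fun x => by
    simpa using ((hasDerivAt_id x).sub_const x0).const_mul s
  have dg : ∀ (A : Polynomial ℝ) x, HasDerivAt
      (fun x => A.eval (s * (x - x0)) * Real.exp (-(1/4) * (s * (x - x0))^2))
      (s * (A.derivative.eval (s * (x - x0)) - 1/2 * (s * (x - x0)) * A.eval (s * (x - x0)))
        * Real.exp (-(1/4) * (s * (x - x0))^2)) x := by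
    intro A x
    have h1 := (A.hasDerivAt (s * (x - x0))).comp x (aff x)
    have h2 := (((aff x).pow 2).const_mul (-(1/4))).exp
    refine (h1.mul h2).congr_deriv ?_
    simp only [Function.comp_apply, Pi.pow_apply]
    push_cast
    ring
  have lim : ∀ (A : Polynomial ℝ), Tendsto
      (fun x => A.eval (s * (x - x0)) * Real.exp (-(1/4) * (s * (x - x0))^2)) (cocompact ℝ) (𝓝 0) := by
    intro A
    refine (poly_gauss A).comp ?_
    rw [cocompact_eq_atBot_atTop]
    refine Tendsto.sup_sup ?_ ?_
    · exact (tendsto_atBot_add_const_right _ _ tendsto_id).const_mul_atBot hs0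
    · exact (tendsto_atTop_add_const_right _ _ tendsto_id).const_mul_atTop hs0
  have bd : ∀ {f : ℝ → ℝ} {l : Filter ℝ}, Tendsto f l (𝓝 0) → ∃ C, ∀ᶠ x in l, |f x| ≤ C := by
    intro f l h
    refine ⟨1, ?_⟩
    filter_upwards [h.abs.eventually (eventually_le_nhds (show |(0:ℝ)| < 1 by simp))] with x hx using hx
  have ltop : (atTop : Filter ℝ) ≤ cocompact ℝ := atTop_le_cocompact
  have lbot : Tendsto (fun x : ℝ => -x) atTop (cocompact ℝ) :=
    tendsto_neg_atTop_atBot.mono_right atBot_le_cocompact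
  have d1 : ∀ x, HasDerivAt (fun x => P.eval (s * (x - x0)) * Real.exp (-(1/4) * (s * (x - x0))^2))
      (Q.eval (s * (x - x0)) * Real.exp (-(1/4) * (s * (x - x0))^2)) x := fun x =>
    (dg P x).congr_deriv (by simp [hQ])
  have d2 : ∀ x, HasDerivAt (fun x => Q.eval (s * (x - x0)) * Real.exp (-(1/4) * (s * (x - x0))^2))
      ((m^2 * (x - x0)^2 - m * (2 * n + 1)) *
        (P.eval (s * (x - x0)) * Real.exp (-(1/4) * (s * (x - x0))^2))) x := fun x => by
    refine (dg Q x).congr_deriv ?_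
    have h := ode' (s * (x - x0))
    have hm2 : m = s^2/2 := by linarith
    simp only [hQ, Polynomial.derivative_mul, Polynomial.derivative_sub, Polynomial.derivative_C,
      Polynomial.derivative_X, Polynomial.eval_mul, Polynomial.eval_sub, Polynomial.eval_add,
      Polynomial.eval_C, Polynomial.eval_X, Polynomial.eval_zero, Polynomial.eval_one,
      zero_mul, zero_add, mul_one]
    rw [hm2]
    linear_combination (s^2 * Real.exp (-(1/4) * (s * (x - x0))^2)) * h
  refine ⟨_, _, P, ⟨⟨d1, d2, (lim P).mono_left ltop, bd ((lim Q).mono_left ltop)⟩,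
    ⟨?_, ?_, (lim P).comp lbot, ?_⟩⟩, ?_, ?_, ?_⟩
  · intro x
    exact ((d1 (-x)).comp x (hasDerivAt_neg x)).congr_deriv (by ring)
  · intro x
    exact ((d2 (-x)).comp x (hasDerivAt_neg x)).neg.congr_deriv (by ring)
  · simpa only [abs_neg, Function.comp_apply] using bd ((lim Q).comp lbot)
  · exact Polynomial.natDegree_map_le.trans Polynomial.natDegree_hermite.le
  · exact ((Polynomial.hermite_monic n).map _).ne_zero
  · intro x hx
    exact (mul_eq_zero.1 hx).resolve_right (Real.exp_pos _).ne'

lemma prim_facts {b : ℝ → ℝ} {m bp bm M : ℝ} (hb : Bfield b m bp bm M) :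
    Continuous (prim b) ∧ ∀ x y, x ≤ y → m * (y - x) ≤ prim b y - prim b x := by
  obtain ⟨hmeas, ⟨C, hC⟩, hm, hge, -⟩ := hb
  have hbint : ∀ x y, IntervalIntegrable b volume x y := by
    intro x y
    refine (intervalIntegrable_const (c := C)).mono_fun' hmeas.aestronglyMeasurable ?_
    exact Eventually.of_forall fun s => hC s
  refine ⟨intervalIntegral.continuous_primitive hbint 0, fun x y hxy => ?_⟩
  have h1 : prim b y - prim b x = ∫ t in x..y, b t :=
    intervalIntegral.integral_interval_sub_left (hbint _ _) (hbint _ _)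
  rw [h1]
  have h2 : ∫ t in x..y, m ≤ ∫ t in x..y, b t :=
    intervalIntegral.integral_mono_ae hxy intervalIntegrable_const (hbint _ _) hge
  simpa [mul_comm] using h2

lemma pot_facts {b : ℝ → ℝ} {m bp bm M : ℝ} (hb : Bfield b m bp bm M) (k : ℝ) :
    Continuous (pot b k) ∧ ∃ x0, ∀ x, m^2 * (x - x0)^2 ≤ pot b k x := by
  obtain ⟨hc, hge⟩ := prim_facts hb
  have hm : 0 < m := hb.2.2.1
  refine ⟨(hc.sub continuous_const).pow 2, ?_⟩
  have p0 : prim b 0 = 0 := by simp [prim]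
  obtain ⟨x0, hx0⟩ : ∃ x0, prim b x0 = k := by
    have hK : 0 ≤ |k| / m := by positivity
    have h1 := hge 0 (|k|/m) hK
    have h2 := hge (-(|k|/m)) 0 (by linarith)
    have h3 : m * (|k| / m) = |k| := by field_simp
    have h4 := le_abs_self k
    have h5 := neg_abs_le k
    obtain ⟨x, -, hx⟩ := intermediate_value_Icc (show -(|k|/m) ≤ |k|/m by linarith)
      hc.continuousOn (show k ∈ Icc _ _ from ⟨by nlinarith, by nlinarith⟩)
    exact ⟨x, hx⟩
  refine ⟨x0, fun x => ?_⟩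
  unfold pot
  rw [← hx0, ← mul_pow]
  rcases le_total x0 x with h | h
  · exact pow_le_pow_left₀ (mul_nonneg hm.le (by linarith)) (hge x0 x h) 2
  · have := pow_le_pow_left₀ (mul_nonneg hm.le (by linarith)) (hge x x0 h) 2
    linarith

/-- the lower bound `ν_n(k) ≥ m (n + 1/2)` for the bands of `O_b(k)`. -/
theorem band_lower_bound
    (b : ℝ → ℝ) (m bp bm M : ℝ) (hb : Bfield b m bp bm M)
    (ν : ℝ → ℕ → ℝ) (hν : ∀ k, IsEigList b k (ν k)) :
    ∀ k : ℝ, ∀ n : ℕ, m * ((n : ℝ) + 1/2) ≤ ν k n := by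
  intro k n
  have hm : 0 < m := hb.2.2.1
  obtain ⟨hpc, x0, hpot⟩ := pot_facts hb k
  obtain ⟨hmono, hex, -⟩ := hν k
  choose H hH using hex
  have sol : ∀ j, Sol (fun x => pot b k x - ν k j) (H j) (deriv (H j)) := by
    intro j
    obtain ⟨h1, h2, h3, h4, h5⟩ := hH j
    refine decay_both (R := |x0| + (|ν k j| + 1) / m + 1 / m) ?_ ?_ h3 ?_
    · exact fun x => (h1.differentiable (by norm_num) x).hasDerivAt
    · exact fun x => (h2 x).hasDerivAt.congr_deriv (by linarith [h5 x])
    · intro x hx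
      have h6 := hpot x
      have h7 : |x| - |x0| ≤ |x - x0| := abs_sub_abs_le_abs_sub x x0
      have h8 : (|ν k j| + 1) / m + 1 / m ≤ |x - x0| := by linarith
      have h9 : |ν k j| + 1 + 1 ≤ m * |x - x0| := by
        have := mul_le_mul_of_nonneg_left h8 hm.le
        have e : m * ((|ν k j| + 1) / m + 1 / m) = |ν k j| + 1 + 1 := by field_simp
        linarith
      have h10 : m^2 * (x - x0)^2 = (m * |x - x0|)^2 := by rw [mul_pow, sq_abs]
      have := le_abs_self (ν k j)
      have := abs_nonneg (ν k j)
      nlinarith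
  have nz : ∀ j, ∀ s t : ℝ, s < t → ∃ c ∈ Ioo s t, H j c ≠ 0 := fun j =>
    ode_nz (hpc.sub continuous_const) (sol j).1.du (sol j).1.dv (hH j).2.2.2.1
  have chain : ∀ j, Chain j (H j) := by
    intro j
    induction j with
    | zero => exact chain_zero _
    | succ j ih =>
      obtain ⟨y, hy, hy'⟩ := chain_zeros (sol j) (sol (j+1))
        (fun x => by have := hmono (Nat.lt_succ_self j); simp only [Nat.succ_eq_add_one] at this; linarith) (nz j) ih
      exact chain_of_zeros y hy hy'
  suffices h : m * (2 * n + 1) ≤ ν k n by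
    have : 0 ≤ m * n := by positivity
    nlinarith
  by_contra! hlt
  obtain ⟨w, z, P, hw, hdeg, hP, hz⟩ := hermite_sol m x0 hm n
  obtain ⟨y, hy, hy'⟩ := chain_zeros (sol n) hw (fun x => by have := hpot x; linarith) (nz n) (chain n)
  have hs0 : 0 < Real.sqrt (2*m) := Real.sqrt_pos.2 (by positivity)
  have hym : StrictMonoOn y (Iic n) := strictMonoOn_Iic_of_lt_succ (by simpa using hy)
  have hcard : n + 1 ≤ P.natDegree := by
    have hinj : Set.InjOn (fun i => Real.sqrt (2*m) * (y i - x0)) (Finset.range (n+1)) := by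
      intro i hi j hj hij
      have hi' : i < n + 1 := by simpa using hi
      have hj' : j < n + 1 := by simpa using hj
      have := mul_left_cancel₀ hs0.ne' hij
      exact hym.injOn (show i ≤ n by omega) (show j ≤ n by omega) (by linarith)
    have h1 := Finset.card_image_of_injOn hinj
    rw [Finset.card_range] at h1
    rw [← h1]
    refine le_trans (Finset.card_le_card ?_) (P.roots.toFinset_card_le.trans P.card_roots')
    intro r hr
    obtain ⟨i, hi, rfl⟩ := Finset.mem_image.1 hr
    have hi' : i < n + 1 := by simpa using hi
    rw [Multiset.mem_toFinset, Polynomial.mem_roots hP]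
    exact hz _ (hy' i (by omega))
  omega
end

section
/- With b as above, if in addition b is monotone (nondecreasing), then for every n ∈ ℕ the band function k ↦ ν_n(k) is monotone nondecreasing in k. -/
open MeasureTheory Filter

open scoped RealInnerProductSpace InnerProductSpace Topology ENNReal

namespace BandMono

/-- A compact operator attains its largest singular value. -/
theorem top_eig {K G : Type*} [NormedAddCommGroup K] [InnerProductSpace ℝ K] [CompleteSpace K]
    [NormedAddCommGroup G] [InnerProductSpace ℝ G] [CompleteSpace G]
    (A : K →L[ℝ] G) (hA : IsCompactOperator A) (w0 : K) (hw0 : w0 ≠ 0) (c : ℝ) (hc : 0 < c)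
    (h : c * ‖w0‖ ^ 2 ≤ ‖A w0‖ ^ 2) :
    ∃ w : K, w ≠ 0 ∧ ∃ τ, c ≤ τ ∧ ∀ y, ⟪A w, A y⟫ = τ * ⟪w, y⟫ := by
  let T : K →L[ℝ] K := (ContinuousLinearMap.adjoint A) ∘L A
  have hTin : ∀ x y, ⟪T x, y⟫ = ⟪A x, A y⟫ := fun x y => by
    simp [T, ContinuousLinearMap.adjoint_inner_left]
  have hT : IsCompactOperator T := hA.clm_comp (ContinuousLinearMap.adjoint A)
  have hsym : T.IsSymmetric := fun x y => by
    change ⟪T x, y⟫ = ⟪x, T y⟫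
    rw [hTin, real_inner_comm (T y) x, hTin, real_inner_comm]
  have : Nontrivial K := ⟨w0, 0, hw0⟩
  have hR : ∀ x, T.rayleighQuotient x = ‖A x‖ ^ 2 / ‖x‖ ^ 2 := fun x => by
    simp only [ContinuousLinearMap.rayleighQuotient, ContinuousLinearMap.reApplyInnerSelf_apply]
    rw [hTin, real_inner_self_eq_norm_sq]; simp
  have hcT : c ≤ ‖T‖ := by
    refine le_trans ?_ ((le_abs_self _).trans (T.rayleighQuotient_le_norm w0))
    rw [hR, le_div_iff₀ (by positivity)]; exact h
  have hev : Module.End.HasEigenvalue (T : Module.End ℝ K) ‖T‖ := by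
    rw [hT.hasEigenvalue_iff_mem_spectrum (by linarith)]
    by_contra hn
    have hn' : algebraMap ℝ ℝ ‖T‖ ∈ resolventSet ℝ T := by
      simpa [spectrum] using hn
    obtain ⟨ε, he, hle⟩ := T.rayleighQuotient_le_of_norm_mem_resolventSet hn'
    have h1 := T.norm_eq_iSup_rayleighQuotient hsym
    have : ‖T‖ ≤ ‖T‖ - ε := by
      conv_lhs => rw [h1]
      refine ciSup_le fun x => ?_
      rw [abs_of_nonneg]
      · exact hle x
      · rw [hR]; positivity
    linarith
  obtain ⟨w, hw⟩ := hev.exists_hasEigenvector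
  refine ⟨w, hw.2, ‖T‖, hcT, fun y => ?_⟩
  have := hw.apply_eq_smul
  have h2 : T w = ‖T‖ • w := this
  rw [← hTin, h2, real_inner_smul_left]

/-- An operator that is approximable by finite-dimensional subspaces is compact. -/
theorem compact_of_approx {H G : Type*} [NormedAddCommGroup H] [InnerProductSpace ℝ H]
    [NormedAddCommGroup G] [InnerProductSpace ℝ G] [CompleteSpace G]
    (J : H →L[ℝ] G) (S : Set H) (hS : Dense S)
    (happ : ∀ ε > 0, ∃ F : Submodule ℝ G, FiniteDimensional ℝ F ∧
      ∀ x ∈ S, ∃ s ∈ F, ‖J x - s‖ ≤ ε * ‖x‖) : IsCompactOperator J := by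
  have hcl : IsClosed {T : H →L[ℝ] G | IsCompactOperator T} := isClosed_setOfPred_isCompactOperator
  have : J ∈ closure {T : H →L[ℝ] G | IsCompactOperator T} := by
    rw [Metric.mem_closure_iff]
    intro ε hε
    obtain ⟨F, hF, hx⟩ := happ (ε / 2) (by positivity)
    refine ⟨F.starProjection ∘L J, ?_, ?_⟩
    · have h1 : IsCompactOperator (F.orthogonalProjectionOnto ∘L J) :=
        isCompactOperator_of_locallyCompactSpace_dom (F.orthogonalProjectionOnto ∘L J)
      exact h1.clm_comp F.subtypeL
    · rw [dist_eq_norm]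
      refine lt_of_le_of_lt (ContinuousLinearMap.opNorm_le_bound _ (by positivity : (0:ℝ) ≤ ε / 2) ?_) (by linarith)
      intro x
      have hcl2 : IsClosed {x | ‖(J - F.starProjection ∘L J) x‖ ≤ ε / 2 * ‖x‖} :=
        isClosed_le (by fun_prop) (by fun_prop)
      refine closure_minimal (s := S) ?_ hcl2 (hS x)
      · intro y hy
        rw [Set.mem_ofPred_eq]
        obtain ⟨s, hs, hle⟩ := hx y hy
        refine le_trans ?_ hle
        simp only [sub_apply, ContinuousLinearMap.comp_apply]
        rw [Submodule.starProjection_minimal]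
        exact ciInf_le ⟨0, by rintro _ ⟨z, rfl⟩; exact norm_nonneg _⟩ (⟨s, hs⟩ : F)
  rwa [hcl.closure_eq] at this

end BandMono

namespace BandMono

/-- Eigenpairs of `-d²/dx² + a²`. -/
def Eig (a : ℝ → ℝ) (μ : ℝ) (H : ℝ → ℝ) : Prop :=
  ContDiff ℝ 1 H ∧ Differentiable ℝ (deriv H) ∧
  Integrable (fun x => (H x) ^ 2) ∧ H ≠ 0 ∧
  ∀ x, -(deriv (deriv H) x) + (a x) ^ 2 * H x = μ * H x

/-- A smooth part of the form domain. -/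
def Dom (a : ℝ → ℝ) : Submodule ℝ (ℝ → ℝ) where
  carrier := {v | ContDiff ℝ 1 v ∧ MemLp v 2 ∧ MemLp (deriv v) 2 ∧ MemLp (fun x => a x * v x) 2}
  zero_mem' := by
    refine ⟨contDiff_const, MemLp.zero, ?_, ?_⟩
    · have : deriv (0 : ℝ → ℝ) = 0 := by ext x; simp
      rw [this]; exact MemLp.zero
    · simp
  add_mem' := by
    rintro v w ⟨h1, h2, h3, h4⟩ ⟨g1, g2, g3, g4⟩
    refine ⟨h1.add g1, h2.add g2, ?_, ?_⟩
    · have : deriv (v + w) = deriv v + deriv w := by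
        ext x
        exact deriv_add (h1.differentiable one_ne_zero x) (g1.differentiable one_ne_zero x)
      rw [this]; exact h3.add g3
    · have : (fun x => a x * (v + w) x) = (fun x => a x * v x) + (fun x => a x * w x) := by
        ext x; simp [mul_add]
      rw [this]; exact h4.add g4
  smul_mem' := by
    rintro c v ⟨h1, h2, h3, h4⟩
    refine ⟨h1.const_smul c, h2.const_smul c, ?_, ?_⟩
    · have : deriv (c • v) = c • deriv v := by
        ext x
        exact deriv_const_smul c (h1.differentiable one_ne_zero x)
      rw [this]; exact h3.const_smul c
    · have : (fun x => a x * (c • v) x) = c • (fun x => a x * v x) := by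
        ext x; simp; ring
      rw [this]; exact h4.const_smul c

theorem Eig.hd {a : ℝ → ℝ} {μ : ℝ} {H : ℝ → ℝ} (h : Eig a μ H) (x : ℝ) :
    HasDerivAt H (deriv H x) x := (h.1.differentiable one_ne_zero x).hasDerivAt

theorem Eig.hd2 {a : ℝ → ℝ} {μ : ℝ} {H : ℝ → ℝ} (h : Eig a μ H) (x : ℝ) :
    HasDerivAt (deriv H) ((a x ^ 2 - μ) * H x) x := by
  have h1 := (h.2.1 x).hasDerivAt
  have h2 := h.2.2.2.2 x
  have : deriv (deriv H) x = (a x ^ 2 - μ) * H x := by linarith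
  rwa [this] at h1

theorem Eig.mem_dom {a : ℝ → ℝ} (ha : Continuous a) {μ : ℝ} {H : ℝ → ℝ} (h : Eig a μ H) :
    H ∈ Dom a := by
  have cH : Continuous H := h.1.continuous
  have cH' : Continuous (deriv H) := h.1.continuous_deriv le_rfl
  have hint := h.2.2.1
  set g : ℝ → ℝ := fun x => (1/2) * deriv H x ^ 2 + a x ^ 2 * H x ^ 2 with hg
  have cg : Continuous g := by fun_prop
  have g0 : ∀ x, 0 ≤ g x := fun x => by positivity
  set C : ℝ := |μ| + 8 with hC
  have key : ∀ R : ℝ, 1 ≤ R → ∫ x in (-(R/2))..(R/2), g x ≤ 2 * (C * ∫ x, H x ^ 2) := by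
    intro R hR
    have hR0 : 0 < R := by linarith
    let χ : ℝ → ℝ := fun x => 1 - (x / R) ^ 2
    let χ' : ℝ → ℝ := fun x => - (2 * x / R ^ 2)
    have cχ : Continuous χ := by fun_prop
    have cχ' : Continuous χ' := by fun_prop
    have dχ : ∀ x, HasDerivAt χ (χ' x) x := fun x => by
      have := (((hasDerivAt_id x).div_const R).pow 2).const_sub 1
      convert! this using 1
      simp [χ']; field_simp
    let P : ℝ → ℝ := fun x => 2 * χ x * χ' x * (H x * deriv H x) +
      χ x ^ 2 * (deriv H x * deriv H x + H x * ((a x ^ 2 - μ) * H x))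
    have cP : Continuous P := by fun_prop
    have hP : ∫ x in (-R)..R, P x = 0 := by
      rw [intervalIntegral.integral_eq_sub_of_hasDerivAt
        (f := fun x => χ x ^ 2 * (H x * deriv H x))]
      · simp [χ, hR0.ne', neg_div]
      · intro x _
        have := ((dχ x).pow 2).mul ((h.hd x).mul (h.hd2 x))
        convert! this using 1
        simp [P]
      · exact cP.intervalIntegrable _ _
    have hpt : ∀ x ∈ Set.Icc (-R) R, χ x ^ 2 * g x ≤ P x + C * H x ^ 2 := by
      intro x hx
      have hx2 : (x / R) ^ 2 ≤ 1 := by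
        rw [div_pow, div_le_one (by positivity)]
        nlinarith [hx.1, hx.2]
      have h1 : χ x ^ 2 ≤ 1 := by
        have : 0 ≤ (x / R) ^ 2 := by positivity
        simp only [χ]; nlinarith
      have h2 : χ' x ^ 2 ≤ 4 := by
        have : χ' x ^ 2 = 4 * (x / R) ^ 2 * (1 / R ^ 2) := by simp [χ']; field_simp; ring
        rw [this]
        have h3 : 1 / R ^ 2 ≤ 1 := by
          rw [div_le_one (by positivity)]; nlinarith
        have h4 : 0 ≤ (x / R) ^ 2 := by positivity
        have h5 : 0 ≤ 1 / R ^ 2 := by positivity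
        nlinarith
      have e1 : χ' x ^ 2 * H x ^ 2 ≤ 4 * H x ^ 2 := by gcongr
      have e2 : χ x ^ 2 * (μ * H x ^ 2) ≤ |μ| * H x ^ 2 := by
        have : μ * H x ^ 2 ≤ |μ| * H x ^ 2 := by gcongr; exact le_abs_self μ
        have h6 : 0 ≤ |μ| * H x ^ 2 := by positivity
        nlinarith [sq_nonneg (χ x)]
      simp only [P, hg, hC]
      nlinarith [sq_nonneg (χ x * deriv H x + 2 * χ' x * H x)]
    have hI1 : ∫ x in (-R)..R, χ x ^ 2 * g x ≤ ∫ x in (-R)..R, (P x + C * H x ^ 2) := by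
      apply intervalIntegral.integral_mono_on (by linarith)
      · exact Continuous.intervalIntegrable (by fun_prop) _ _
      · exact Continuous.intervalIntegrable (by fun_prop) _ _
      · exact hpt
    rw [intervalIntegral.integral_add (cP.intervalIntegrable _ _)
      (Continuous.intervalIntegrable (by fun_prop) _ _), hP, zero_add,
      intervalIntegral.integral_const_mul] at hI1
    have hI2 : ∫ x in (-R)..R, H x ^ 2 ≤ ∫ x, H x ^ 2 := by
      rw [intervalIntegral.integral_of_le (by linarith)]
      exact setIntegral_le_integral hint (Filter.Eventually.of_forall fun x => sq_nonneg _)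
    have hI3 : ∫ x in (-(R/2))..(R/2), g x ≤ ∫ x in (-(R/2))..(R/2), 2 * (χ x ^ 2 * g x) := by
      apply intervalIntegral.integral_mono_on (by linarith)
      · exact cg.intervalIntegrable _ _
      · exact Continuous.intervalIntegrable (by fun_prop) _ _
      · intro x hx
        have hx2 : (x / R) ^ 2 ≤ 1 / 4 := by
          rw [div_pow, div_le_iff₀ (by positivity)]
          nlinarith [hx.1, hx.2]
        have h1 : 3 / 4 ≤ χ x := by simp only [χ]; linarith
        have h2 : 1 ≤ 2 * χ x ^ 2 := by nlinarith
        nlinarith [g0 x]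
    have hI4 : ∫ x in (-(R/2))..(R/2), χ x ^ 2 * g x ≤ ∫ x in (-R)..R, χ x ^ 2 * g x := by
      apply intervalIntegral.integral_mono_interval (by linarith) (by linarith) (by linarith)
      · exact Filter.Eventually.of_forall fun x => mul_nonneg (sq_nonneg _) (g0 x)
      · exact Continuous.intervalIntegrable (by fun_prop) _ _
    rw [intervalIntegral.integral_const_mul] at hI3
    have hC0 : 0 ≤ C := by positivity
    have : C * ∫ x in (-R)..R, H x ^ 2 ≤ C * ∫ x, H x ^ 2 := by gcongr
    linarith
  have gint : Integrable g := by
    refine integrable_of_intervalIntegral_norm_bounded (ι := ℝ) (l := atTop)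
      (a := fun R => -(R/2)) (b := fun R => R/2) (2 * (C * ∫ x, H x ^ 2)) ?_ ?_ ?_ ?_
    · intro R
      exact (cg.integrableOn_Icc).mono_set Set.Ioc_subset_Icc_self
    · exact tendsto_neg_atTop_atBot.comp (tendsto_id.atTop_div_const (by norm_num))
    · exact tendsto_id.atTop_div_const (by norm_num)
    · filter_upwards [eventually_ge_atTop 1] with R hR
      have : (fun x => ‖g x‖) = g := by ext x; rw [Real.norm_of_nonneg (g0 x)]
      simp_rw [Real.norm_of_nonneg (g0 _)]
      exact key R hR
  refine ⟨h.1, ?_, ?_, ?_⟩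
  · exact (memLp_two_iff_integrable_sq cH.aestronglyMeasurable).2 hint
  · rw [memLp_two_iff_integrable_sq cH'.aestronglyMeasurable]
    refine (gint.const_mul 2).mono' (by fun_prop) (Filter.Eventually.of_forall fun x => ?_)
    rw [Real.norm_of_nonneg (sq_nonneg _)]
    simp only [hg]; nlinarith [mul_nonneg (sq_nonneg (a x)) (sq_nonneg (H x))]
  · rw [memLp_two_iff_integrable_sq (by fun_prop)]
    refine gint.mono' (by fun_prop) (Filter.Eventually.of_forall fun x => ?_)
    rw [Real.norm_of_nonneg (sq_nonneg _)]
    simp only [hg]; nlinarith [sq_nonneg (deriv H x)]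

theorem Eig.form {a : ℝ → ℝ} (ha : Continuous a) {μ : ℝ} {H v : ℝ → ℝ} (h : Eig a μ H)
    (hv : v ∈ Dom a) :
    (∫ x, H x * v x) + (∫ x, deriv H x * deriv v x) + (∫ x, (a x * H x) * (a x * v x)) =
      (μ + 1) * ∫ x, H x * v x := by
  obtain ⟨v1, v2, v3, v4⟩ := hv
  obtain ⟨H1, H2, H3, H4⟩ := h.mem_dom ha
  have i1 : Integrable (fun x => H x * v x) := H2.integrable_mul v2
  have i2 : Integrable (fun x => deriv H x * deriv v x) := H3.integrable_mul v3
  have i3 : Integrable (fun x => (a x * H x) * (a x * v x)) := H4.integrable_mul v4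
  have i4 : Integrable (fun x => v x * ((a x ^ 2 - μ) * H x)) := by
    refine (i3.sub (i1.const_mul μ)).congr (Filter.Eventually.of_forall fun x => ?_)
    simp; ring
  have := integral_mul_deriv_eq_deriv_mul_of_integrable (u := v) (u' := deriv v) (v := deriv H)
    (v' := fun x => (a x ^ 2 - μ) * H x)
    (fun x _ => (v1.differentiable one_ne_zero x).hasDerivAt) (fun x _ => h.hd2 x) i4
    (v3.integrable_mul H3) (v2.integrable_mul H3)
  have e1 : ∫ x, v x * ((a x ^ 2 - μ) * H x) =
      (∫ x, (a x * H x) * (a x * v x)) - μ * ∫ x, H x * v x := by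
    rw [← integral_const_mul, ← integral_sub i3 (i1.const_mul μ)]
    congr 1; ext x; ring
  have e2 : ∫ x, deriv v x * deriv H x = ∫ x, deriv H x * deriv v x := by
    congr 1; ext x; ring
  rw [e1, e2] at this
  linarith

theorem ode_zero {u u1 q : ℝ → ℝ} (hq : Continuous q) (hu : ∀ x, HasDerivAt u (u1 x) x)
    (hu1 : ∀ x, HasDerivAt u1 (q x * u x) x) (x0 : ℝ) (h0 : u x0 = 0) (h1 : u1 x0 = 0) :
    u = 0 := by
  ext x
  let A := min x x0 - 1
  let B := max x x0 + 1
  obtain ⟨Q, hQ⟩ := (isCompact_Icc (a := A) (b := B)).exists_bound_of_continuousOn hq.continuousOn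
  let K : NNReal := Real.toNNReal (max 1 Q)
  have hK : (K : ℝ) = max 1 Q := Real.coe_toNNReal _ (by positivity)
  have := ODE_solution_unique_of_mem_Ioo (E := ℝ × ℝ) (v := fun t p => (p.2, q t * p.1))
    (s := fun _ => Set.univ) (K := K) (a := A) (b := B) (t₀ := x0)
    (f := fun t => (u t, u1 t)) (g := fun _ => (0, 0)) ?_ ?_ ?_ ?_ ?_
  · have hx : x ∈ Set.Ioo A B := by
      constructor
      · have := min_le_left x x0; simp only [A]; linarith
      · have := le_max_left x x0; simp only [B]; linarith
    simpa using congrArg Prod.fst (this hx)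
  · intro t ht
    refine LipschitzOnWith.of_dist_le_mul fun p _ r _ => ?_
    rw [hK, Prod.dist_eq, Prod.dist_eq]
    simp only [Real.dist_eq]
    have hQt := hQ t (Set.Ioo_subset_Icc_self ht)
    rw [Real.norm_eq_abs] at hQt
    have m0 : 0 ≤ max |p.1 - r.1| |p.2 - r.2| := le_max_of_le_left (abs_nonneg _)
    apply max_le
    · calc |p.2 - r.2| ≤ max |p.1 - r.1| |p.2 - r.2| := le_max_right _ _
        _ = 1 * max |p.1 - r.1| |p.2 - r.2| := (one_mul _).symm
        _ ≤ _ := by gcongr; exact le_max_left _ _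
    · rw [← mul_sub, abs_mul]
      gcongr
      · exact hQt.trans (le_max_right _ _)
      · exact le_max_left _ _
  · constructor
    · have := min_le_right x x0; simp only [A]; linarith
    · have := le_max_right x x0; simp only [B]; linarith
  · intro t _
    exact ⟨(hu t).prodMk (hu1 t), trivial⟩
  · intro t _
    refine ⟨?_, trivial⟩
    convert! hasDerivAt_const t ((0:ℝ), (0:ℝ)) using 1
    simp
  · simp [h0, h1]

theorem Eig.unique {a : ℝ → ℝ} (ha : Continuous a) {μ : ℝ} {F φ : ℝ → ℝ} (hF : Eig a μ F)
    (hφ : Eig a μ φ) : ∃ c : ℝ, F = c • φ := by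
  obtain ⟨F1, F2, F3, F4⟩ := hF.mem_dom ha
  obtain ⟨p1, p2, p3, p4⟩ := hφ.mem_dom ha
  let W : ℝ → ℝ := fun x => F x * deriv φ x - deriv F x * φ x
  have dW : ∀ x, HasDerivAt W 0 x := fun x => by
    have := ((hF.hd x).mul (hφ.hd2 x)).sub ((hF.hd2 x).mul (hφ.hd x))
    convert! this using 1
    ring
  have iW : Integrable W := (F2.integrable_mul p3).sub (F3.integrable_mul p2)
  have cW : ∀ x y, W x = W y := is_const_of_deriv_eq_zero (fun x => (dW x).differentiableAt)
    (fun x => (dW x).deriv)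
  obtain ⟨x0, hx0⟩ : ∃ x0, φ x0 ≠ 0 := by
    by_contra hcon
    push Not at hcon
    exact hφ.2.2.2.1 (funext hcon)
  have W0 : W x0 = 0 := by
    have : W = fun _ => W x0 := funext fun x => cW x x0
    rw [this, integrable_const_iff] at iW
    rcases iW with h | h
    · exact h
    · exfalso
      have := h.measure_univ_lt_top
      simp at this
  have hz := ode_zero (u := fun x => φ x0 * F x - F x0 * φ x)
    (u1 := fun x => φ x0 * deriv F x - F x0 * deriv φ x) (q := fun x => a x ^ 2 - μ)
    (by fun_prop) (fun x => ((hF.hd x).const_mul _).sub ((hφ.hd x).const_mul _))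
    (fun x => by
      have := ((hF.hd2 x).const_mul (φ x0)).sub ((hφ.hd2 x).const_mul (F x0))
      convert! this using 1
      ring) x0 (by ring) (by simp only [W] at W0; linarith)
  refine ⟨F x0 / φ x0, ?_⟩
  ext x
  have := congrFun hz x
  simp only [Pi.zero_apply] at this
  simp only [Pi.smul_apply, smul_eq_mul]
  field_simp
  linarith

end BandMono

namespace BandMono

theorem exists_supp_Ioo {v : ℝ → ℝ} (hs : HasCompactSupport v) :
    ∃ R : ℝ, 0 < R ∧ ∀ S, R ≤ S → tsupport v ⊆ Set.Ioo (-S) S := by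
  obtain ⟨R, hR0, hR⟩ := hs.isCompact.isBounded.subset_ball_lt 0 0
  refine ⟨R, hR0, fun S hS x hx => ?_⟩
  have := hR hx
  rw [Metric.mem_ball, dist_zero_right, Real.norm_eq_abs, abs_lt] at this
  constructor <;> linarith [this.1, this.2]

theorem integral_eq_interval {f v : ℝ → ℝ} {S : ℝ} (hv : tsupport v ⊆ Set.Ioo (-S) S)
    (hf : ∀ x, v x = 0 → f x = 0) : ∫ x in (-S)..S, f x = ∫ x, f x := by
  apply intervalIntegral.integral_eq_integral_of_support_subset
  intro x hx
  have : x ∈ tsupport v := subset_tsupport _ (fun h => hx (hf x h))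
  exact Set.Ioo_subset_Ioc_self (hv this)

theorem weak_ibp {q v : ℝ → ℝ} (hq : LocallyIntegrable q) (hv : ContDiff ℝ 1 v)
    (hs : HasCompactSupport v) :
    ∫ x, (∫ t in (0:ℝ)..x, q t) * deriv v x = -∫ x, q x * v x := by
  obtain ⟨S, hS0, hS⟩ := exists_supp_Ioo hs
  replace hS := hS S le_rfl
  have hqi : ∀ a b, IntervalIntegrable q volume a b := fun a b => (hq.integrableOn_isCompact isCompact_uIcc).intervalIntegrable
  have hv0 : ∀ x, x ∉ Set.Ioo (-S) S → v x = 0 := fun x hx =>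
    image_eq_zero_of_notMem_tsupport fun h => hx (hS h)
  have dsupp : tsupport (deriv v) ⊆ Set.Ioo (-S) S := (tsupport_deriv_subset (𝕜 := ℝ) (f := v)).trans hS
  rw [← integral_eq_interval (v := deriv v) dsupp (fun x hx => by simp [hx]),
    ← integral_eq_interval (f := fun x => q x * v x) hS (fun x hx => by simp [hx])]
  have ac1 : AbsolutelyContinuousOnInterval (fun x => ∫ t in (0:ℝ)..x, q t) (-S) S :=
    (hqi _ _).absolutelyContinuousOnInterval_intervalIntegral
      (by rw [Set.uIcc_of_le (by linarith)]; constructor <;> linarith)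
  have ac2 : AbsolutelyContinuousOnInterval v (-S) S :=
    hv.contDiffOn.absolutelyContinuousOnInterval
  rw [ac1.integral_mul_deriv_eq_deriv_mul ac2, hv0 S (by simp), hv0 (-S) (by simp)]
  simp only [mul_zero, sub_self, zero_sub, neg_inj]
  apply intervalIntegral.integral_congr_ae
  filter_upwards [(hqi (-S) S).ae_hasDerivAt_integral] with x hx hx2
  rw [(hx (Set.uIoc_subset_uIcc hx2) 0
    (by rw [Set.uIcc_of_le (by linarith)]; constructor <;> linarith)).deriv]

theorem du_bois {r : ℝ → ℝ} (hr : LocallyIntegrable r)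
    (h : ∀ v : ℝ → ℝ, ContDiff ℝ 1 v → HasCompactSupport v → ∫ x, r x * deriv v x = 0) :
    ∃ c, ∀ᵐ x, r x = c := by
  let f : ContDiffBump (0:ℝ) := ⟨1, 2, by norm_num, by norm_num⟩
  let ρ : ℝ → ℝ := f.normed volume
  have cρ : Continuous ρ := f.continuous_normed
  have sρ : HasCompactSupport ρ := f.hasCompactSupport_normed
  have iρ : ∫ x, ρ x = 1 := f.integral_normed
  refine ⟨∫ x, r x * ρ x, ?_⟩
  set c := ∫ x, r x * ρ x with hc
  have irs : ∀ g : ℝ → ℝ, Continuous g → HasCompactSupport g → Integrable (fun x => r x * g x) := by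
    intro g cg sg
    have := hr.integrable_smul_left_of_hasCompactSupport cg sg
    refine this.congr (Filter.Eventually.of_forall fun x => ?_)
    simp [mul_comm]
  apply ae_eq_of_integral_contDiff_smul_eq hr (locallyIntegrable_const c)
  intro g hg sg
  have cg := hg.continuous
  set I := ∫ x, g x with hI
  let k : ℝ → ℝ := fun x => g x - I * ρ x
  have ck : Continuous k := by fun_prop
  have ig : Integrable g := cg.integrable_of_hasCompactSupport sg
  have iρ' : Integrable ρ := cρ.integrable_of_hasCompactSupport sρ
  have ik : ∫ x, k x = 0 := by
    rw [integral_sub ig (iρ'.const_mul I), integral_const_mul, iρ, ← hI]; ring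
  obtain ⟨S1, h1, hS1⟩ := exists_supp_Ioo sg
  obtain ⟨S2, h2, hS2⟩ := exists_supp_Ioo sρ
  let S := max S1 S2
  have g0 : ∀ x, x ∉ Set.Ioo (-S) S → g x = 0 := fun x hx =>
    image_eq_zero_of_notMem_tsupport fun h => hx (hS1 S (le_max_left _ _) h)
  have ρ0 : ∀ x, x ∉ Set.Ioo (-S) S → ρ x = 0 := fun x hx =>
    image_eq_zero_of_notMem_tsupport fun h => hx (hS2 S (le_max_right _ _) h)
  have k0 : ∀ x, x ∉ Set.Ioo (-S) S → k x = 0 := fun x hx => by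
    simp only [k]; rw [g0 x hx, ρ0 x hx]; ring
  have hSS : 0 < S := lt_max_of_lt_left h1
  let v : ℝ → ℝ := fun x => ∫ t in (-S)..x, k t
  have dv : ∀ x, HasDerivAt v (k x) x := fun x =>
    intervalIntegral.integral_hasDerivAt_right (ck.intervalIntegrable _ _)
      (ck.stronglyMeasurableAtFilter _ _) ck.continuousAt
  have dv' : deriv v = k := funext fun x => (dv x).deriv
  have v1 : ContDiff ℝ 1 v := by
    rw [contDiff_one_iff_deriv]
    exact ⟨fun x => (dv x).differentiableAt, by rw [dv']; exact ck⟩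
  have vs : HasCompactSupport v := by
    apply HasCompactSupport.intro (isCompact_Icc (a := -S) (b := S))
    intro x hx
    rcases lt_or_ge x (-S) with hlt | hge
    · simp only [v]
      rw [intervalIntegral.integral_congr (g := fun _ => 0)]
      · simp
      · intro t ht
        rw [Set.uIcc_of_ge hlt.le] at ht
        exact k0 t (fun h => by linarith [h.1, ht.2])
    · have hxS : S < x := by
        by_contra hcon
        exact hx ⟨hge, not_lt.1 hcon⟩
      simp only [v]
      rw [intervalIntegral.integral_eq_integral_of_support_subset, ik]
      intro t ht
      have : t ∈ Set.Ioo (-S) S := by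
        by_contra hcon
        exact ht (k0 t hcon)
      exact ⟨this.1, by linarith [this.2]⟩
  have := h v v1 vs
  rw [dv'] at this
  have e : ∫ x, r x * k x = (∫ x, r x * g x) - I * c := by
    rw [hc, ← integral_const_mul, ← integral_sub (irs g cg sg) ((irs ρ cρ sρ).const_mul I)]
    congr 1; ext x; simp only [k]; ring
  rw [e] at this
  simp only [smul_eq_mul]
  rw [integral_mul_const, ← hI]
  have e2 : ∫ x, g x * r x = ∫ x, r x * g x := by congr 1; ext x; ring
  rw [e2]; linarith

theorem weak_deriv {p q : ℝ → ℝ} (hp : LocallyIntegrable p) (hq : LocallyIntegrable q)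
    (h : ∀ v : ℝ → ℝ, ContDiff ℝ 1 v → HasCompactSupport v →
      ∫ x, p x * deriv v x = -∫ x, q x * v x) :
    ∃ c, ∀ᵐ x, p x = c + ∫ t in (0:ℝ)..x, q t := by
  have cQ : Continuous (fun x => ∫ t in (0:ℝ)..x, q t) :=
    intervalIntegral.continuous_primitive (fun a b => (hq.integrableOn_isCompact isCompact_uIcc).intervalIntegrable) 0
  have hQ : LocallyIntegrable (fun x => ∫ t in (0:ℝ)..x, q t) := cQ.locallyIntegrable
  obtain ⟨c, hc⟩ := du_bois (r := fun x => p x - ∫ t in (0:ℝ)..x, q t) (hp.sub hQ) (by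
    intro v hv hs
    have cd : Continuous (deriv v) := hv.continuous_deriv le_rfl
    have sd : HasCompactSupport (deriv v) := hs.deriv
    have i1 : Integrable (fun x => p x * deriv v x) := by
      refine (hp.integrable_smul_left_of_hasCompactSupport cd sd).congr
        (Filter.Eventually.of_forall fun x => ?_)
      simp [mul_comm]
    have i2 : Integrable (fun x => (∫ t in (0:ℝ)..x, q t) * deriv v x) := by
      refine (hQ.integrable_smul_left_of_hasCompactSupport cd sd).congr
        (Filter.Eventually.of_forall fun x => ?_)
      simp [mul_comm]
    simp_rw [sub_mul]
    rw [integral_sub i1 i2, h v hv hs, weak_ibp hq hv hs]; ring)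
  refine ⟨c, ?_⟩
  filter_upwards [hc] with x hx
  linarith

end BandMono

namespace BandMono

/-- Real square integrable functions on the line. -/
noncomputable abbrev L2 := Lp ℝ 2 (volume : Measure ℝ)

/-- Triples of square integrable functions. -/
noncomputable abbrev X3 := PiLp 2 (fun _ : Fin 3 => L2)

theorem inner_toLp (f : L2) {v : ℝ → ℝ} (hv : MemLp v 2) :
    ⟪f, hv.toLp v⟫ = ∫ x, f x * v x := by
  rw [L2.inner_def]
  apply integral_congr_ae
  filter_upwards [hv.coeFn_toLp] with x hx
  rw [hx]; simp [mul_comm]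

theorem inner_toLp2 {u v : ℝ → ℝ} (hu : MemLp u 2) (hv : MemLp v 2) :
    ⟪hu.toLp u, hv.toLp v⟫ = ∫ x, u x * v x := by
  rw [inner_toLp]
  apply integral_congr_ae
  filter_upwards [hu.coeFn_toLp] with x hx
  rw [hx]

theorem normsq_toLp {u : ℝ → ℝ} (hu : MemLp u 2) : ‖hu.toLp u‖ ^ 2 = ∫ x, u x ^ 2 := by
  rw [← real_inner_self_eq_norm_sq, inner_toLp2]
  congr 1; ext x; ring

theorem Dom.c1 {a v : ℝ → ℝ} (h : v ∈ Dom a) : ContDiff ℝ 1 v := h.1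
theorem Dom.l0 {a v : ℝ → ℝ} (h : v ∈ Dom a) : MemLp v 2 := h.2.1
theorem Dom.l1 {a v : ℝ → ℝ} (h : v ∈ Dom a) : MemLp (deriv v) 2 := h.2.2.1
theorem Dom.l2 {a v : ℝ → ℝ} (h : v ∈ Dom a) : MemLp (fun x => a x * v x) 2 := h.2.2.2

/-- The embedding `v ↦ (v, dv, a v)`. -/
noncomputable def iota (a : ℝ → ℝ) : Dom a →ₗ[ℝ] X3 where
  toFun v := WithLp.toLp 2 ![(Dom.l0 v.2).toLp _, (Dom.l1 v.2).toLp _, (Dom.l2 v.2).toLp _]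
  map_add' v w := by
    ext i : 1
    fin_cases i
    · exact MemLp.toLp_add (Dom.l0 v.2) (Dom.l0 w.2)
    · refine Eq.trans ?_ (MemLp.toLp_add (Dom.l1 v.2) (Dom.l1 w.2))
      refine MemLp.toLp_congr (Dom.l1 (v + w).2) ((Dom.l1 v.2).add (Dom.l1 w.2))
        (Filter.Eventually.of_forall fun x => ?_)
      exact deriv_add ((Dom.c1 v.2).differentiable one_ne_zero x)
        ((Dom.c1 w.2).differentiable one_ne_zero x)
    · refine Eq.trans ?_ (MemLp.toLp_add (Dom.l2 v.2) (Dom.l2 w.2))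
      refine MemLp.toLp_congr (Dom.l2 (v + w).2) ((Dom.l2 v.2).add (Dom.l2 w.2))
        (Filter.Eventually.of_forall fun x => ?_)
      simp [mul_add]
  map_smul' c v := by
    ext i : 1
    fin_cases i
    · exact MemLp.toLp_const_smul c (Dom.l0 v.2)
    · refine Eq.trans ?_ (MemLp.toLp_const_smul c (Dom.l1 v.2))
      refine MemLp.toLp_congr (Dom.l1 (c • v).2) ((Dom.l1 v.2).const_smul c)
        (Filter.Eventually.of_forall fun x => ?_)
      exact deriv_const_smul c ((Dom.c1 v.2).differentiable one_ne_zero x)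
    · refine Eq.trans ?_ (MemLp.toLp_const_smul c (Dom.l2 v.2))
      refine MemLp.toLp_congr (Dom.l2 (c • v).2) ((Dom.l2 v.2).const_smul c)
        (Filter.Eventually.of_forall fun x => ?_)
      simp; ring

theorem iota_0 {a : ℝ → ℝ} (v : Dom a) : (iota a v) 0 = (Dom.l0 v.2).toLp _ := rfl
theorem iota_1 {a : ℝ → ℝ} (v : Dom a) : (iota a v) 1 = (Dom.l1 v.2).toLp _ := rfl
theorem iota_2 {a : ℝ → ℝ} (v : Dom a) : (iota a v) 2 = (Dom.l2 v.2).toLp _ := rfl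

theorem inner_iota {a : ℝ → ℝ} (x : X3) (v : Dom a) :
    ⟪x, iota a v⟫ = (∫ t, x 0 t * v.1 t) + (∫ t, x 1 t * deriv v.1 t) +
      ∫ t, x 2 t * (a t * v.1 t) := by
  rw [PiLp.inner_apply, Fin.sum_univ_three, iota_0, iota_1, iota_2, inner_toLp, inner_toLp,
    inner_toLp]

theorem inner_iota2 {a : ℝ → ℝ} (u v : Dom a) :
    ⟪iota a u, iota a v⟫ = (∫ t, u.1 t * v.1 t) + (∫ t, deriv u.1 t * deriv v.1 t) +
      ∫ t, (a t * u.1 t) * (a t * v.1 t) := by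
  rw [PiLp.inner_apply, Fin.sum_univ_three, iota_0, iota_1, iota_2, iota_0, iota_1, iota_2,
    inner_toLp2, inner_toLp2, inner_toLp2]

theorem normsq_iota {a : ℝ → ℝ} (v : Dom a) :
    ‖iota a v‖ ^ 2 = (∫ t, v.1 t ^ 2) + (∫ t, deriv v.1 t ^ 2) + ∫ t, (a t * v.1 t) ^ 2 := by
  rw [← real_inner_self_eq_norm_sq, inner_iota2]
  congr 1
  · congr 1
    · congr 1; ext x; ring
    · congr 1; ext x; ring
  · congr 1; ext x; ring

/-- The form domain. -/
noncomputable def HH (a : ℝ → ℝ) : Submodule ℝ X3 := (LinearMap.range (iota a)).topologicalClosure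

instance (a : ℝ → ℝ) : CompleteSpace (HH a) :=
  (Submodule.isClosed_topologicalClosure _).completeSpace_coe

/-- The embedding of the form domain in `L²`. -/
noncomputable def JJ (a : ℝ → ℝ) : HH a →L[ℝ] L2 :=
  (PiLp.proj 2 (fun _ : Fin 3 => L2) 0 : X3 →L[ℝ] L2) ∘L (HH a).subtypeL

theorem JJ_apply (a : ℝ → ℝ) (x : HH a) : JJ a x = x.1 0 := rfl

/-- Elements of the form domain from nice functions. -/
noncomputable def io (a : ℝ → ℝ) (v : Dom a) : HH a :=
  ⟨iota a v, Submodule.le_topologicalClosure _ ⟨v, rfl⟩⟩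

theorem dense_io (a : ℝ → ℝ) : Dense (Set.range (io a)) := by
  rw [Subtype.dense_iff]
  intro x hx
  refine closure_mono ?_ hx
  rintro _ ⟨v, rfl⟩
  exact ⟨io a v, ⟨v, rfl⟩, rfl⟩

theorem sq_diff_le {v : ℝ → ℝ} (hv : ContDiff ℝ 1 v) (h2 : Integrable (fun x => deriv v x ^ 2))
    {y x : ℝ} (hyx : y ≤ x) : (v x - v y) ^ 2 ≤ (x - y) * ∫ t, deriv v t ^ 2 := by
  have cd : Continuous (deriv v) := hv.continuous_deriv le_rfl
  have e1 : ∫ t in y..x, deriv v t = v x - v y :=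
    intervalIntegral.integral_deriv_eq_sub (fun t _ => hv.differentiable one_ne_zero t)
      (cd.intervalIntegrable _ _)
  have e2 : ∫ t in y..x, deriv v t ^ 2 ≤ ∫ t, deriv v t ^ 2 := by
    rw [intervalIntegral.integral_of_le hyx]
    exact setIntegral_le_integral h2 (Filter.Eventually.of_forall fun x => sq_nonneg _)
  rcases hyx.eq_or_lt with rfl | hlt
  · simp
  have key : ∀ m : ℝ, 0 ≤ (∫ t in y..x, deriv v t ^ 2) - 2 * m * (v x - v y) + m ^ 2 * (x - y) := by
    intro m
    have h0 : 0 ≤ ∫ t in y..x, (deriv v t - m) ^ 2 :=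
      intervalIntegral.integral_nonneg hyx fun t _ => sq_nonneg _
    have e3 : ∫ t in y..x, (deriv v t - m) ^ 2 =
        (∫ t in y..x, deriv v t ^ 2) - 2 * m * (v x - v y) + m ^ 2 * (x - y) := by
      have : ∀ t, (deriv v t - m) ^ 2 = deriv v t ^ 2 - 2 * m * deriv v t + m ^ 2 := fun t => by ring
      simp_rw [this]
      rw [intervalIntegral.integral_add, intervalIntegral.integral_sub,
        intervalIntegral.integral_const_mul, e1, intervalIntegral.integral_const]
      · simp [mul_comm]
      all_goals exact Continuous.intervalIntegrable (by fun_prop) _ _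
    linarith
  have hxy : 0 < x - y := by linarith
  have := key ((v x - v y) / (x - y))
  have e4 : (∫ t in y..x, deriv v t ^ 2) - 2 * ((v x - v y) / (x - y)) * (v x - v y) +
      ((v x - v y) / (x - y)) ^ 2 * (x - y) =
      (∫ t in y..x, deriv v t ^ 2) - (v x - v y) ^ 2 / (x - y) := by
    field_simp; ring
  rw [e4] at this
  have h5 : (v x - v y) ^ 2 / (x - y) ≤ ∫ t, deriv v t ^ 2 := by linarith
  rw [div_le_iff₀ hxy] at h5
  linarith

set_option maxHeartbeats 1000000 in
theorem JJ_compact {a : ℝ → ℝ} (hinf : ∀ C : ℝ, ∃ R : ℝ, 0 < R ∧ ∀ x, R ≤ |x| → C ≤ a x ^ 2) :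
    IsCompactOperator (JJ a) := by
  refine compact_of_approx (JJ a) (Set.range (io a)) (dense_io a) ?_
  intro ε hε
  obtain ⟨R, hR0, hR⟩ := hinf (1 / ε ^ 2)
  obtain ⟨N, hN⟩ := exists_nat_gt (2 * R * R / ε ^ 2)
  have hN0 : (0:ℝ) < N := lt_of_le_of_lt (by positivity) hN
  set δ : ℝ := R / N with hδ
  have hδ0 : 0 < δ := by positivity
  have hNδ : N * δ = R := by rw [hδ]; field_simp
  have hsmall : 2 * R * δ ≤ ε ^ 2 := by
    rw [hδ, ← mul_div_assoc, div_le_iff₀ hN0]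
    rw [div_lt_iff₀ (by positivity)] at hN
    linarith
  let cell : ℤ → Set ℝ := fun j => Set.Ico (j * δ) ((j + 1) * δ)
  have hcell : ∀ j x, x ∈ cell j ↔ ⌊x / δ⌋ = j := fun j x => by
    rw [Int.floor_eq_iff, le_div_iff₀ hδ0, div_lt_iff₀ hδ0]; rfl
  have mcell : ∀ j, MeasurableSet (cell j) := fun j => measurableSet_Ico
  have hmem : ∀ j, MemLp ((cell j).indicator (fun _ => (1:ℝ))) 2 (volume : Measure ℝ) := fun j =>
    memLp_indicator_const 2 (mcell j) 1 (Or.inr (by simp [cell]))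
  let e : ℤ → L2 := fun j => (hmem j).toLp _
  let I : Finset ℤ := Finset.Ico (-(N:ℤ)) N
  refine ⟨Submodule.span ℝ (Set.image e (I : Set ℤ)), ?_, ?_⟩
  · exact FiniteDimensional.span_of_finite ℝ (I.finite_toSet.image e)
  rintro _ ⟨v, rfl⟩
  refine ⟨∑ j ∈ I, v.1 (j * δ) • e j, ?_, ?_⟩
  · refine Submodule.sum_mem _ fun j hj => Submodule.smul_mem _ _ (Submodule.subset_span ?_)
    exact Set.mem_image_of_mem e (Finset.mem_coe.2 hj)
  have v1 := Dom.c1 v.2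
  have v0 := Dom.l0 v.2
  have i0 : Integrable (fun x => v.1 x ^ 2) := v0.integrable_sq
  have i1 : Integrable (fun x => deriv v.1 x ^ 2) := (Dom.l1 v.2).integrable_sq
  have i2 : Integrable (fun x => (a x * v.1 x) ^ 2) := (Dom.l2 v.2).integrable_sq
  set D := ∫ x, deriv v.1 x ^ 2 with hD
  have D0 : 0 ≤ D := integral_nonneg fun x => sq_nonneg _
  have hae : (JJ a (io a v) - ∑ j ∈ I, v.1 (j * δ) • e j : L2) =ᵐ[volume]
      fun x => v.1 x - if ⌊x / δ⌋ ∈ I then v.1 (⌊x / δ⌋ * δ) else 0 := by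
    have h1 : ∀ᵐ x, ∀ j : ℤ, e j x = (cell j).indicator (fun _ => (1:ℝ)) x :=
      ae_all_iff.2 fun j => (hmem j).coeFn_toLp
    have h2 : ((∑ j ∈ I, v.1 (j * δ) • e j : L2) : ℝ → ℝ) =ᵐ[volume]
        ∑ j ∈ I, ((v.1 (j * δ) • e j : L2) : ℝ → ℝ) := Lp.coeFn_finsetSum _ _
    have h3 : ∀ᵐ x, ∀ j : ℤ, (v.1 (j * δ) • e j : L2) x = v.1 (j * δ) * e j x :=
      ae_all_iff.2 fun j => Lp.coeFn_smul (v.1 (j * δ)) (e j)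
    have h4 : JJ a (io a v) = v0.toLp _ := rfl
    filter_upwards [h1, h2, h3, v0.coeFn_toLp,
      Lp.coeFn_sub (JJ a (io a v)) (∑ j ∈ I, v.1 (j * δ) • e j)] with x g1 g2 g3 g4 g5
    rw [g5, Pi.sub_apply, g2, h4, g4, Finset.sum_apply]
    congr 1
    simp_rw [g3, g1, Set.indicator_apply, hcell]
    simp
  have hnorm : ‖JJ a (io a v) - ∑ j ∈ I, v.1 (j * δ) • e j‖ ^ 2 ≤
      ∫ x, ((Set.Ico (-R) R).indicator (fun _ => δ * D) x + ε ^ 2 * (a x * v.1 x) ^ 2) := by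
    rw [← real_inner_self_eq_norm_sq, L2.inner_def]
    apply integral_mono_ae
    · exact L2.integrable_inner _ _
    · refine Integrable.add ?_ (i2.const_mul _)
      rw [integrable_indicator_iff measurableSet_Ico]
      exact integrableOn_const (by simp)
    filter_upwards [hae] with x hx
    rw [hx]
    have hIx : ⌊x / δ⌋ ∈ I ↔ x ∈ Set.Ico (-R) R := by
      simp only [I, Finset.mem_Ico, Set.mem_Ico]
      rw [Int.le_floor, Int.floor_lt, le_div_iff₀ hδ0, div_lt_iff₀ hδ0]
      push_cast
      rw [neg_mul, hNδ]
    by_cases hxI : x ∈ Set.Ico (-R) R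
    · rw [if_pos (hIx.2 hxI), Set.indicator_of_mem hxI]
      have hf1 : ⌊x / δ⌋ * δ ≤ x := by
        rw [← le_div_iff₀ hδ0]; exact Int.floor_le _
      have hf2 : x < (⌊x / δ⌋ + 1) * δ := by
        rw [← div_lt_iff₀ hδ0]; exact Int.lt_floor_add_one _
      have := sq_diff_le v1 i1 hf1
      rw [real_inner_self_eq_norm_sq, Real.norm_eq_abs, sq_abs]
      have h5 : (x - ⌊x / δ⌋ * δ) * D ≤ δ * D := by
        gcongr; linarith
      have h6 : 0 ≤ ε ^ 2 * (a x * v.1 x) ^ 2 := by positivity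
      linarith
    · rw [if_neg (fun h => hxI (hIx.1 h)), Set.indicator_of_notMem hxI]
      rw [real_inner_self_eq_norm_sq, Real.norm_eq_abs, sq_abs, sub_zero, zero_add]
      have hxR : R ≤ |x| := by
        by_contra hcon
        push Not at hcon
        rw [abs_lt] at hcon
        exact hxI ⟨hcon.1.le, hcon.2⟩
      have := hR x hxR
      rw [div_le_iff₀ (by positivity)] at this
      rw [mul_pow]
      nlinarith [sq_nonneg (v.1 x)]
  have hcalc : ∫ x, ((Set.Ico (-R) R).indicator (fun _ => δ * D) x + ε ^ 2 * (a x * v.1 x) ^ 2) =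
      2 * R * δ * D + ε ^ 2 * ∫ x, (a x * v.1 x) ^ 2 := by
    rw [integral_add _ (i2.const_mul _), integral_const_mul, integral_indicator measurableSet_Ico]
    · simp [hR0.le]; ring
    · rw [integrable_indicator_iff measurableSet_Ico]
      exact integrableOn_const (by simp)
  have hio : ‖io a v‖ ^ 2 = (∫ t, v.1 t ^ 2) + D + ∫ t, (a t * v.1 t) ^ 2 := normsq_iota v
  have hi0 : 0 ≤ ∫ t, v.1 t ^ 2 := integral_nonneg fun x => sq_nonneg _
  rw [← sq_le_sq₀ (norm_nonneg _) (by positivity), mul_pow, hio]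
  rw [hcalc] at hnorm
  nlinarith [sq_nonneg ε]

end BandMono

namespace BandMono

theorem cont_coord (a : ℝ → ℝ) (i : Fin 3) : Continuous (fun y : HH a => y.1 i) :=
  ((PiLp.proj 2 (fun _ : Fin 3 => L2) i : X3 →L[ℝ] L2) ∘L (HH a).subtypeL).continuous

theorem weak1 {a : ℝ → ℝ} (x : HH a) {v : ℝ → ℝ} (hv : ContDiff ℝ 1 v) (hc : HasCompactSupport v) :
    ∫ t, x.1 0 t * deriv v t = -∫ t, x.1 1 t * v t := by
  have m0 : MemLp v 2 (volume : Measure ℝ) := hv.continuous.memLp_of_hasCompactSupport hc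
  have cd : Continuous (deriv v) := hv.continuous_deriv le_rfl
  have m1 : MemLp (deriv v) 2 (volume : Measure ℝ) := cd.memLp_of_hasCompactSupport hc.deriv
  rw [← inner_toLp _ m0, ← inner_toLp _ m1]
  have := (show DenseRange (io a) from dense_io a).equalizer
    (g := fun y : HH a => ⟪y.1 0, m1.toLp _⟫) (h := fun y : HH a => -⟪y.1 1, m0.toLp _⟫)
    ((cont_coord a 0).inner continuous_const) ((cont_coord a 1).inner continuous_const).neg ?_
  · exact congrFun this x
  ext u
  have u1 := Dom.c1 u.2
  have u0 := Dom.l0 u.2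
  have ud := Dom.l1 u.2
  have e0 : (io a u).1 0 = u0.toLp _ := rfl
  have e1 : (io a u).1 1 = ud.toLp _ := rfl
  simp only [Function.comp]
  rw [e0, e1, inner_toLp2, inner_toLp2]
  exact integral_mul_deriv_eq_deriv_mul_of_integrable
    (fun t _ => (u1.differentiable one_ne_zero t).hasDerivAt)
    (fun t _ => (hv.differentiable one_ne_zero t).hasDerivAt)
    (u0.integrable_mul m1) (ud.integrable_mul m0) (u0.integrable_mul m0)

theorem weak2 {a : ℝ → ℝ} (ha : Continuous a) (x : HH a) {v : ℝ → ℝ} (hv : Continuous v)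
    (hc : HasCompactSupport v) :
    ∫ t, x.1 2 t * v t = ∫ t, x.1 0 t * (a t * v t) := by
  have m0 : MemLp v 2 (volume : Measure ℝ) := hv.memLp_of_hasCompactSupport hc
  have m1 : MemLp (fun t => a t * v t) 2 (volume : Measure ℝ) :=
    (ha.mul hv).memLp_of_hasCompactSupport hc.mul_left
  rw [← inner_toLp _ m0, ← inner_toLp _ m1]
  have := (show DenseRange (io a) from dense_io a).equalizer
    (g := fun y : HH a => ⟪y.1 2, m0.toLp _⟫) (h := fun y : HH a => ⟪y.1 0, m1.toLp _⟫)
    ((cont_coord a 2).inner continuous_const) ((cont_coord a 0).inner continuous_const) ?_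
  · exact congrFun this x
  ext u
  have u0 := Dom.l0 u.2
  have ud := Dom.l2 u.2
  have e0 : (io a u).1 0 = u0.toLp _ := rfl
  have e1 : (io a u).1 2 = ud.toLp _ := rfl
  simp only [Function.comp]
  rw [e0, e1, inner_toLp2, inner_toLp2]
  congr 1; ext t; ring

theorem form_io {a : ℝ → ℝ} (ha : Continuous a) {ν : ℝ} {φ : ℝ → ℝ} (h : Eig a ν φ) (y : HH a) :
    ⟪io a ⟨φ, h.mem_dom ha⟩, y⟫ = (ν + 1) * ⟪JJ a (io a ⟨φ, h.mem_dom ha⟩), JJ a y⟫ := by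
  set Φ : HH a := io a ⟨φ, h.mem_dom ha⟩ with hΦ
  have := (show DenseRange (io a) from dense_io a).equalizer
    (g := fun y : HH a => ⟪Φ, y⟫) (h := fun y : HH a => (ν + 1) * ⟪JJ a Φ, JJ a y⟫)
    (continuous_const.inner continuous_id)
    (continuous_const.mul (continuous_const.inner (JJ a).continuous)) ?_
  · exact congrFun this y
  ext u
  simp only [Function.comp]
  have e1 : ⟪Φ, io a u⟫ = ⟪iota a ⟨φ, h.mem_dom ha⟩, iota a u⟫ := rfl
  have e2 : ⟪JJ a Φ, JJ a (io a u)⟫ =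
    ⟪(Dom.l0 (h.mem_dom ha)).toLp φ, (Dom.l0 u.2).toLp u.1⟫ := rfl
  rw [e1, e2, inner_iota2, inner_toLp2]
  exact h.form ha u.2

theorem locInt (f : L2) : LocallyIntegrable f := (Lp.memLp f).locallyIntegrable (by norm_num)

theorem compact_mem_dom {a v : ℝ → ℝ} (ha : Continuous a) (hv : ContDiff ℝ 1 v)
    (hc : HasCompactSupport v) : v ∈ Dom a :=
  ⟨hv, hv.continuous.memLp_of_hasCompactSupport hc,
    (hv.continuous_deriv le_rfl).memLp_of_hasCompactSupport hc.deriv,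
    (ha.mul hv.continuous).memLp_of_hasCompactSupport hc.mul_left⟩

set_option maxHeartbeats 1000000 in
theorem regularity {a : ℝ → ℝ} (ha : Continuous a) (w : HH a) (hw : w ≠ 0) (τ : ℝ) (hτ : 0 < τ)
    (h : ∀ y, ⟪JJ a w, JJ a y⟫ = τ * ⟪w, y⟫) :
    ∃ F, Eig a (1 / τ - 1) F ∧ (JJ a w : ℝ → ℝ) =ᵐ[volume] F := by
  set μ := 1 / τ - 1 with hμ
  set f : ℝ → ℝ := ((w.1 0 : L2) : ℝ → ℝ) with hf
  set g : ℝ → ℝ := ((w.1 1 : L2) : ℝ → ℝ) with hg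
  have lf : LocallyIntegrable f := locInt _
  have lg : LocallyIntegrable g := locInt _
  have cq : Continuous (fun x => a x ^ 2 - μ) := by fun_prop
  have lq : LocallyIntegrable (fun x => (a x ^ 2 - μ) * f x) := by
    rw [← locallyIntegrableOn_univ] at lf ⊢
    exact LocallyIntegrableOn.continuousOn_mul lf cq.continuousOn isOpen_univ.isLocallyClosed
  have key : ∀ v : ℝ → ℝ, ContDiff ℝ 1 v → HasCompactSupport v →
      ∫ x, g x * deriv v x = -∫ x, ((a x ^ 2 - μ) * f x) * v x := by
    intro v hv hc
    have hd := compact_mem_dom ha hv hc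
    have hca : HasCompactSupport (fun t => a t * v t) := hc.mul_left
    have h1 := h (io a ⟨v, hd⟩)
    have e1 : ⟪w, io a ⟨v, hd⟩⟫ = ⟪w.1, iota a ⟨v, hd⟩⟫ := rfl
    have e2 : ⟪JJ a w, JJ a (io a ⟨v, hd⟩)⟫ = ⟪w.1 0, (Dom.l0 hd).toLp v⟫ := rfl
    rw [e1, e2, inner_iota, inner_toLp] at h1
    have h2 := weak2 ha w (ha.mul hv.continuous) hca
    change ∫ t, w.1 2 t * (a t * v t) = ∫ t, f t * (a t * (a t * v t)) at h2
    rw [h2] at h1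
    change ∫ t, f t * v t = τ * ((∫ t, f t * v t) + (∫ t, g t * deriv v t) +
      ∫ t, f t * (a t * (a t * v t))) at h1
    have i1 : Integrable (fun t => f t * v t) :=
      (Lp.memLp (w.1 0)).integrable_mul (Dom.l0 hd)
    have i2 : Integrable (fun t => f t * (a t * (a t * v t))) := by
      have m2 : MemLp (fun t => a t * (a t * v t)) 2 (volume : Measure ℝ) :=
        (ha.mul (ha.mul hv.continuous)).memLp_of_hasCompactSupport hca.mul_left
      exact (Lp.memLp (w.1 0)).integrable_mul m2
    have e3 : ∫ x, ((a x ^ 2 - μ) * f x) * v x =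
        (∫ t, f t * (a t * (a t * v t))) - μ * ∫ t, f t * v t := by
      rw [← integral_const_mul, ← integral_sub i2 (i1.const_mul μ)]
      congr 1; ext t; ring
    rw [e3, hμ]
    clear_value f g
    generalize (∫ t, f t * (a t * (a t * v t))) = A at h1 ⊢
    generalize (∫ t, f t * v t) = B at h1 ⊢
    generalize (∫ t, g t * deriv v t) = C at h1 ⊢
    field_simp
    linarith
  obtain ⟨c', hc'⟩ := weak_deriv lg lq key
  obtain ⟨c, hc⟩ := weak_deriv lf lg (fun v hv hs => weak1 w hv hs)
  set G0 : ℝ → ℝ := fun x => c' + ∫ t in (0:ℝ)..x, (a t ^ 2 - μ) * f t with hG0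
  set F : ℝ → ℝ := fun x => c + ∫ t in (0:ℝ)..x, g t with hF
  have cG : Continuous G0 := continuous_const.add (intervalIntegral.continuous_primitive
    (fun a b => (lq.integrableOn_isCompact isCompact_uIcc).intervalIntegrable) 0)
  have cF : Continuous F := continuous_const.add (intervalIntegral.continuous_primitive
    (fun a b => (lg.integrableOn_isCompact isCompact_uIcc).intervalIntegrable) 0)
  have F' : F = fun x => c + ∫ t in (0:ℝ)..x, G0 t := by
    ext x
    refine congrArg (c + ·) ?_
    apply intervalIntegral.integral_congr_ae
    filter_upwards [hc'] with t ht _ using ht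
  have G' : G0 = fun x => c' + ∫ t in (0:ℝ)..x, (a t ^ 2 - μ) * F t := by
    ext x
    refine congrArg (c' + ·) ?_
    apply intervalIntegral.integral_congr_ae
    filter_upwards [hc] with t ht _
    rw [ht]
  have dF : ∀ x, HasDerivAt F (G0 x) x := fun x => by
    rw [F']
    exact (cG.integral_hasStrictDerivAt 0 x).hasDerivAt.const_add c
  have dG : ∀ x, HasDerivAt G0 ((a x ^ 2 - μ) * F x) x := fun x => by
    rw [G']
    exact ((cq.mul cF).integral_hasStrictDerivAt 0 x).hasDerivAt.const_add c'
  have dF' : deriv F = G0 := funext fun x => (dF x).deriv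
  refine ⟨F, ⟨?_, ?_, ?_, ?_, ?_⟩, hc⟩
  · rw [contDiff_one_iff_deriv, dF']
    exact ⟨fun x => (dF x).differentiableAt, cG⟩
  · rw [dF']; exact fun x => (dG x).differentiableAt
  · refine (Lp.memLp (w.1 0)).integrable_sq.congr ?_
    filter_upwards [hc] with t ht
    exact congrArg (· ^ 2) ht
  · intro h0
    apply hw
    have hz : JJ a w = 0 := by
      rw [JJ_apply, Lp.eq_zero_iff_ae_eq_zero]
      filter_upwards [hc] with t ht
      have : F t = 0 := by rw [h0]; rfl
      exact ht.trans this
    have := h w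
    rw [hz, inner_zero_left] at this
    have h3 : ⟪w, w⟫ = 0 := by
      rcases mul_eq_zero.1 this.symm with h | h
      · exact absurd h hτ.ne'
      · exact h
    exact inner_self_eq_zero.1 h3
  · intro x
    rw [dF', (dG x).deriv]; ring

end BandMono

namespace BandMono

theorem io_sum {a : ℝ → ℝ} {ι : Type*} (s : Finset ι) (c : ι → ℝ) (v : ι → Dom a) :
    io a (∑ j ∈ s, c j • v j) = ∑ j ∈ s, c j • io a (v j) := by
  apply Subtype.ext
  rw [Submodule.coe_sum]
  change iota a (∑ j ∈ s, c j • v j) = _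
  rw [map_sum]
  refine Finset.sum_congr rfl fun j _ => ?_
  rw [map_smul]; rfl

theorem JJ_io {a : ℝ → ℝ} (v : Dom a) : JJ a (io a v) = (Dom.l0 v.2).toLp v.1 := rfl

theorem JJ_io_ne {a : ℝ → ℝ} (v : Dom a) (hv : v.1 ≠ 0) : JJ a (io a v) ≠ 0 := by
  intro h
  rw [JJ_io, Lp.eq_zero_iff_ae_eq_zero] at h
  exact hv (((Dom.c1 v.2).continuous.ae_eq_iff_eq volume continuous_zero).1
    ((Dom.l0 v.2).coeFn_toLp.symm.trans h))

/-- The element of the form domain given by an eigenfunction. -/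
noncomputable def eio {a : ℝ → ℝ} (ha : Continuous a) {ν : ℝ} {φ : ℝ → ℝ} (h : Eig a ν φ) : HH a :=
  io a ⟨φ, h.mem_dom ha⟩

theorem form_eio {a : ℝ → ℝ} (ha : Continuous a) {ν : ℝ} {φ : ℝ → ℝ} (h : Eig a ν φ) (y : HH a) :
    ⟪eio ha h, y⟫ = (ν + 1) * ⟪JJ a (eio ha h), JJ a y⟫ := form_io ha h y

theorem JJ_eio_ne {a : ℝ → ℝ} (ha : Continuous a) {ν : ℝ} {φ : ℝ → ℝ} (h : Eig a ν φ) :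
    JJ a (eio ha h) ≠ 0 := JJ_io_ne _ h.2.2.2.1

theorem eig_pos {a : ℝ → ℝ} (ha : Continuous a) {ν : ℝ} {φ : ℝ → ℝ} (h : Eig a ν φ) :
    0 < ν + 1 := by
  have h1 := form_eio ha h (eio ha h)
  have h2 : eio ha h ≠ 0 := fun h0 => JJ_eio_ne ha h (by rw [h0, map_zero])
  have h3 : 0 < ⟪eio ha h, eio ha h⟫ := real_inner_self_pos.2 h2
  rw [h1] at h3
  exact pos_of_mul_pos_left h3 real_inner_self_nonneg

theorem eio_orth {a : ℝ → ℝ} (ha : Continuous a) {ν μ : ℝ} {φ ψ : ℝ → ℝ} (h : Eig a ν φ)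
    (h' : Eig a μ ψ) (hne : ν ≠ μ) : ⟪JJ a (eio ha h), JJ a (eio ha h')⟫ = 0 := by
  have h1 := form_eio ha h (eio ha h')
  have h2 := form_eio ha h' (eio ha h)
  rw [real_inner_comm] at h2
  rw [real_inner_comm (JJ a (eio ha h)) (JJ a (eio ha h'))] at h2
  have h3 : (ν - μ) * ⟪JJ a (eio ha h), JJ a (eio ha h')⟫ = 0 := by linarith
  rcases mul_eq_zero.1 h3 with h4 | h4
  · exact absurd (sub_eq_zero.1 h4) hne
  · exact h4

theorem dom_le {a1 a2 : ℝ → ℝ} (h1 : Continuous a1) (hle : ∀ x, |a1 x| ≤ |a2 x|) {v : ℝ → ℝ}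
    (hv : v ∈ Dom a2) : v ∈ Dom a1 :=
  ⟨hv.1, hv.2.1, hv.2.2.1, hv.2.2.2.mono
    (h1.mul hv.1.continuous).aestronglyMeasurable
    (Filter.Eventually.of_forall fun x => by
      rw [norm_mul, norm_mul, Real.norm_eq_abs, Real.norm_eq_abs]
      exact mul_le_mul_of_nonneg_right (hle x) (abs_nonneg _))⟩

theorem norm_io_le {a1 a2 : ℝ → ℝ} (h1 : Continuous a1) (hle : ∀ x, |a1 x| ≤ |a2 x|) (v : Dom a2) :
    ‖io a1 ⟨v.1, dom_le h1 hle v.2⟩‖ ^ 2 ≤ ‖io a2 v‖ ^ 2 := by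
  have e1 : ‖io a1 ⟨v.1, dom_le h1 hle v.2⟩‖ = ‖iota a1 ⟨v.1, dom_le h1 hle v.2⟩‖ := rfl
  have e2 : ‖io a2 v‖ = ‖iota a2 v‖ := rfl
  rw [e1, e2, normsq_iota, normsq_iota]
  refine add_le_add le_rfl ?_
  refine integral_mono (Dom.l2 (dom_le h1 hle v.2)).integrable_sq (Dom.l2 v.2).integrable_sq ?_
  intro x
  simp only [mul_pow]
  exact mul_le_mul_of_nonneg_right (sq_le_sq.2 (hle x)) (sq_nonneg _)

theorem energy {a : ℝ → ℝ} (ha : Continuous a) {ν : ℕ → ℝ} (hν : StrictMono ν) {ψ : ℕ → ℝ → ℝ}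
    (h : ∀ n, Eig a (ν n) (ψ n)) (n : ℕ) (c : Fin (n + 1) → ℝ) (hc : c ≠ 0) :
    ‖∑ j, c j • eio ha (h j)‖ ^ 2 ≤ (ν n + 1) * ‖JJ a (∑ j, c j • eio ha (h j))‖ ^ 2 ∧
    JJ a (∑ j, c j • eio ha (h j)) ≠ 0 := by
  set U := ∑ j, c j • eio ha (h j) with hU
  have e1 : ∀ j : Fin (n + 1), ⟪JJ a (eio ha (h j)), JJ a U⟫ = c j * ‖JJ a (eio ha (h j))‖ ^ 2 := by
    intro j
    rw [hU, map_sum, inner_sum, Finset.sum_eq_single j]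
    · rw [map_smul, inner_smul_right, real_inner_self_eq_norm_sq]
    · intro l _ hl
      rw [map_smul, inner_smul_right, eio_orth ha (h j) (h l), mul_zero]
      intro heq
      exact hl (Fin.ext (hν.injective heq)).symm
    · simp
  have e2 : ‖JJ a U‖ ^ 2 = ∑ j : Fin (n + 1), c j ^ 2 * ‖JJ a (eio ha (h j))‖ ^ 2 := by
    rw [← real_inner_self_eq_norm_sq]
    have hm : ∀ W : L2, ⟪JJ a U, W⟫ = ∑ j : Fin (n + 1), c j * ⟪JJ a (eio ha (h j)), W⟫ := by
      intro W
      rw [hU, map_sum, sum_inner]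
      refine Finset.sum_congr rfl fun j _ => ?_
      rw [map_smul, real_inner_smul_left]
    rw [hm]
    refine Finset.sum_congr rfl fun j _ => ?_
    rw [e1]; ring
  have e3 : ‖U‖ ^ 2 = ∑ j : Fin (n + 1), (ν j + 1) * (c j ^ 2 * ‖JJ a (eio ha (h j))‖ ^ 2) := by
    rw [← real_inner_self_eq_norm_sq]
    have hm : ∀ W : HH a, ⟪U, W⟫ = ∑ j : Fin (n + 1), c j * ⟪eio ha (h j), W⟫ := by
      intro W
      rw [hU, sum_inner]
      refine Finset.sum_congr rfl fun j _ => ?_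
      exact real_inner_smul_left (eio ha (h j)) W (c j)
    rw [hm]
    refine Finset.sum_congr rfl fun j _ => ?_
    rw [form_eio, e1]; ring
  constructor
  · rw [e2, e3, Finset.mul_sum]
    refine Finset.sum_le_sum fun j _ => ?_
    refine mul_le_mul_of_nonneg_right ?_ (by positivity)
    have := hν.monotone (Nat.lt_succ_iff.1 j.2)
    linarith
  · intro h0
    apply hc
    ext j
    have := e1 j
    rw [h0, inner_zero_right] at this
    rcases mul_eq_zero.1 this.symm with h2 | h2
    · exact h2
    · exact absurd (norm_eq_zero.1 (pow_eq_zero_iff two_ne_zero |>.1 h2)) (JJ_eio_ne ha (h j))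

theorem deflate {E G : Type*} [NormedAddCommGroup E] [InnerProductSpace ℝ E] [CompleteSpace E]
    [NormedAddCommGroup G] [InnerProductSpace ℝ G] [CompleteSpace G]
    (J : E →L[ℝ] G) (hJ : IsCompactOperator J) {n : ℕ} (Φ : Fin n → E) (κ : Fin n → ℝ)
    (hκ : ∀ i, 0 < κ i) (hform : ∀ i y, ⟪Φ i, y⟫ = κ i * ⟪J (Φ i), J y⟫)
    (w0 : E) (hw0 : w0 ≠ 0) (horth : ∀ i, ⟪Φ i, w0⟫ = 0) (c : ℝ) (hc : 0 < c)
    (h : c * ‖w0‖ ^ 2 ≤ ‖J w0‖ ^ 2) :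
    ∃ w : E, w ≠ 0 ∧ ∃ τ, c ≤ τ ∧ (∀ i, ⟪J (Φ i), J w⟫ = 0) ∧ ∀ y, ⟪J w, J y⟫ = τ * ⟪w, y⟫ := by
  let V : Submodule ℝ E := Submodule.span ℝ (Set.range Φ)
  have : FiniteDimensional ℝ V := FiniteDimensional.span_of_finite ℝ (Set.finite_range Φ)
  have memV : ∀ w : E, w ∈ Vᗮ ↔ ∀ i, ⟪Φ i, w⟫ = 0 := by
    intro w
    constructor
    · intro hw i
      exact (Submodule.mem_orthogonal V w).1 hw _ (Submodule.subset_span ⟨i, rfl⟩)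
    · intro hw
      rw [Submodule.mem_orthogonal]
      intro p hp
      induction hp using Submodule.span_induction with
      | mem x hx => obtain ⟨i, rfl⟩ := hx; exact hw i
      | zero => simp
      | add x y _ _ hx hy => rw [inner_add_left, hx, hy, add_zero]
      | smul r x _ hx => rw [real_inner_smul_left, hx, mul_zero]
  obtain ⟨w, hwne, τ, hτ, hw⟩ := top_eig (J ∘L (Vᗮ).subtypeL) (hJ.comp_clm _)
    ⟨w0, (memV w0).2 horth⟩ (fun h0 => hw0 (congrArg Subtype.val h0)) c hc h
  have hwK := (memV w.1).1 w.2
  have hJΦ : ∀ i, ⟪J (Φ i), J w.1⟫ = 0 := by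
    intro i
    have := hform i w.1
    rw [hwK i] at this
    rcases mul_eq_zero.1 this.symm with h | h
    · exact absurd h (hκ i).ne'
    · exact h
  have hJV : ∀ p ∈ V, ⟪J w.1, J p⟫ = 0 := by
    intro p hp
    induction hp using Submodule.span_induction with
    | mem x hx => obtain ⟨i, rfl⟩ := hx; rw [real_inner_comm]; exact hJΦ i
    | zero => simp
    | add x y _ _ hx hy => rw [map_add, inner_add_right, hx, hy, add_zero]
    | smul r x _ hx => rw [map_smul, real_inner_smul_right, hx, mul_zero]
  refine ⟨w.1, fun h => hwne (Subtype.ext h), τ, hτ, hJΦ, ?_⟩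
  intro y
  obtain ⟨p, hp, q, hq, rfl⟩ := V.exists_add_mem_mem_orthogonal y
  rw [map_add, inner_add_right, inner_add_right, hJV p hp,
    Submodule.inner_left_of_mem_orthogonal hp w.2, zero_add, zero_add]
  exact hw ⟨q, hq⟩

set_option maxHeartbeats 1000000 in
theorem compare {a1 a2 : ℝ → ℝ} (h1 : Continuous a1) (h2 : Continuous a2)
    (hle : ∀ x, |a1 x| ≤ |a2 x|)
    (hinf : ∀ C : ℝ, ∃ R : ℝ, 0 < R ∧ ∀ x, R ≤ |x| → C ≤ a1 x ^ 2)
    {ν1 ν2 : ℕ → ℝ} (hν1 : StrictMono ν1) (hν2 : StrictMono ν2)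
    (he1 : ∀ n, ∃ φ, Eig a1 (ν1 n) φ) (hall : ∀ μ F, Eig a1 μ F → ∃ n, μ = ν1 n)
    (he2 : ∀ n, ∃ ψ, Eig a2 (ν2 n) ψ) (n : ℕ) : ν1 n ≤ ν2 n := by
  by_contra hlt
  push Not at hlt
  choose φ hφ using he1
  choose ψ hψ using he2
  let Φ : Fin n → HH a1 := fun i => eio h1 (hφ i)
  let P : Fin (n + 1) → HH a1 := fun j => io a1 ⟨ψ j, dom_le h1 hle ((hψ j).mem_dom h2)⟩
  let T : (Fin (n + 1) → ℝ) →ₗ[ℝ] (Fin n → ℝ) := LinearMap.pi fun i =>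
    (innerSL ℝ (Φ i)).toLinearMap ∘ₗ Fintype.linearCombination ℝ P
  have hker : LinearMap.ker T ≠ ⊥ := LinearMap.ker_ne_bot_of_finrank_lt (by simp)
  obtain ⟨c, hcT, hc0⟩ := Submodule.exists_mem_ne_zero_of_ne_bot hker
  obtain ⟨en1, en2⟩ := energy h2 hν2 hψ n c hc0
  set w0 : HH a1 := ∑ j, c j • P j with hw0
  have horth : ∀ i, ⟪Φ i, w0⟫ = 0 := by
    intro i
    have := congrFun (LinearMap.mem_ker.1 hcT) i
    change ⟪Φ i, Fintype.linearCombination ℝ P c⟫ = 0 at this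
    rwa [Fintype.linearCombination_apply] at this
  let u : Dom a2 := ∑ j, c j • (⟨ψ j, (hψ j).mem_dom h2⟩ : Dom a2)
  have hu2 : io a2 u = ∑ j, c j • eio h2 (hψ j) := io_sum _ _ _
  have hu1 : io a1 ⟨u.1, dom_le h1 hle u.2⟩ = w0 := by
    rw [hw0]
    have := io_sum (a := a1) Finset.univ c
      (fun j : Fin (n + 1) => ⟨ψ j, dom_le h1 hle ((hψ j).mem_dom h2)⟩)
    refine Eq.trans ?_ this
    congr 1
    apply Subtype.ext
    simp [u]
  have hJ : JJ a1 w0 = JJ a2 (∑ j, c j • eio h2 (hψ j)) := by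
    rw [← hu1, ← hu2]; rfl
  have hJ0 : JJ a1 w0 ≠ 0 := by rw [hJ]; exact en2
  have hnw : ‖w0‖ ^ 2 ≤ (ν2 n + 1) * ‖JJ a1 w0‖ ^ 2 := by
    rw [hJ]
    refine le_trans ?_ en1
    rw [← hu1, ← hu2]
    exact norm_io_le h1 hle u
  have hpos : 0 < ν2 n + 1 := eig_pos h2 (hψ n)
  obtain ⟨w, hwne, τ, hτ, hJΦ, hfull⟩ := deflate (JJ a1) (JJ_compact hinf) Φ
    (fun i => ν1 i + 1) (fun i => eig_pos h1 (hφ i)) (fun i y => form_eio h1 (hφ i) y) w0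
    (fun h0 => hJ0 (by rw [h0, map_zero])) horth (1 / (ν2 n + 1)) (by positivity)
    (by
      rw [one_div, inv_mul_le_iff₀ hpos]
      exact hnw)
  have hτ0 : 0 < τ := lt_of_lt_of_le (by positivity) hτ
  obtain ⟨F, hF, hae⟩ := regularity h1 w hwne τ hτ0 hfull
  obtain ⟨i, hi⟩ := hall _ _ hF
  have hin : i < n := by
    rw [← hν1.lt_iff_lt, ← hi]
    have : 1 / τ ≤ ν2 n + 1 := by
      rw [div_le_iff₀ hτ0]
      rw [div_le_iff₀ hpos] at hτ
      linarith
    linarith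
  rw [hi] at hF
  obtain ⟨r, hr⟩ := hF.unique h1 (hφ i)
  have hJw : JJ a1 w = r • JJ a1 (eio h1 (hφ i)) := by
    apply Lp.ext
    have hm := (Dom.l0 ((hφ i).mem_dom h1)).coeFn_toLp
    filter_upwards [hae, Lp.coeFn_smul r (JJ a1 (eio h1 (hφ i))), hm] with x g1 g2 g3
    rw [g1, g2, hr, Pi.smul_apply, Pi.smul_apply]
    exact congrArg (r • ·) g3.symm
  have h0 : ⟪JJ a1 (eio h1 (hφ i)), JJ a1 w⟫ = 0 := hJΦ ⟨i, hin⟩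
  rw [hJw, inner_smul_right] at h0
  rcases mul_eq_zero.1 h0 with h | h
  · rw [h, zero_smul] at hr
    exact hF.2.2.2.1 hr
  · exact JJ_eio_ne h1 (hφ i) (inner_self_eq_zero.1 h)

end BandMono

namespace BandMono

theorem Eig.shift {a : ℝ → ℝ} {μ : ℝ} {H : ℝ → ℝ} (h : Eig a μ H) (c : ℝ) :
    Eig (fun x => a (x + c)) μ (fun x => H (x + c)) := by
  have d1 : deriv (fun x => H (x + c)) = fun x => deriv H (x + c) :=
    funext fun x => ((h.hd (x + c)).comp_add_const x c).deriv
  have d2 : ∀ x, HasDerivAt (fun x => deriv H (x + c)) ((a (x + c) ^ 2 - μ) * H (x + c)) x :=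
    fun x => (h.hd2 (x + c)).comp_add_const x c
  refine ⟨h.1.comp (contDiff_id.add contDiff_const), ?_, ?_, ?_, ?_⟩
  · rw [d1]; exact fun x => (d2 x).differentiableAt
  · exact h.2.2.1.comp_add_right c
  · intro h0
    apply h.2.2.2.1
    ext x
    have := congrFun h0 (x - c)
    simpa using this
  · intro x
    rw [d1, (d2 x).deriv]; ring

theorem band_le (b : ℝ → ℝ) (m : ℝ) (hm : 0 < m) (hbm : ∀ᵐ s : ℝ, m ≤ b s) (hmono : Monotone b)
    (ν : ℝ → ℕ → ℝ) (hν : ∀ k, IsEigList b k (ν k)) (n : ℕ) {k k' : ℝ} (hk : k ≤ k') :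
    ν k n ≤ ν k' n := by
  have hi : ∀ x y, IntervalIntegrable b volume x y := fun x y => hmono.intervalIntegrable
  have hsub : ∀ x y, prim b y - prim b x = ∫ t in x..y, b t := fun x y =>
    intervalIntegral.integral_interval_sub_left (hi 0 y) (hi 0 x)
  have cp : Continuous (prim b) := intervalIntegral.continuous_primitive hi 0
  have grow : ∀ x y, x ≤ y → m * (y - x) ≤ prim b y - prim b x := by
    intro x y hxy
    rw [hsub]
    have e : ∫ _ in x..y, m = m * (y - x) := by simp [mul_comm]
    rw [← e]
    exact intervalIntegral.integral_mono_ae hxy (by simp) (hi x y) hbm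
  have p0 : prim b 0 = 0 := by simp [prim]
  have surj : ∀ k, ∃ x, prim b x = k := by
    intro k
    have hd : m * (|k| / m) = |k| := by field_simp
    have hp : 0 ≤ |k| / m := by positivity
    refine mem_range_of_exists_le_of_exists_ge cp ⟨-(|k| / m), ?_⟩ ⟨|k| / m, ?_⟩
    · have := grow (-(|k| / m)) 0 (by linarith)
      rw [p0, zero_sub, neg_neg, hd] at this
      linarith [neg_abs_le k]
    · have := grow 0 (|k| / m) hp
      rw [p0, sub_zero, hd] at this
      linarith [le_abs_self k]
  obtain ⟨x1, hx1⟩ := surj k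
  obtain ⟨x2, hx2⟩ := surj k'
  have hc : x1 ≤ x2 := by
    by_contra hcon
    push Not at hcon
    have := grow x2 x1 hcon.le
    nlinarith
  set c := x2 - x1 with hcdef
  have hc0 : 0 ≤ c := by linarith
  have hcomp : ∀ x y, x ≤ y → prim b y - prim b x ≤ prim b (y + c) - prim b (x + c) := by
    intro x y hxy
    rw [hsub, hsub, ← intervalIntegral.integral_comp_add_right]
    exact intervalIntegral.integral_mono hxy (hi x y)
      (Monotone.intervalIntegrable fun s t hst => hmono (by linarith))
      (fun t => hmono (by linarith))
  have e2 : prim b (x1 + c) = k' := by rw [← hx2]; congr 1; linarith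
  refine compare (a1 := fun x => prim b x - k) (a2 := fun x => prim b (x + c) - k')
    (by fun_prop) (by fun_prop) ?_ ?_ (hν k).1 (hν k').1 (hν k).2.1 (hν k).2.2 ?_ n
  · intro x
    rcases le_total x1 x with h | h
    · have g1 := grow x1 x h
      have g2 := hcomp x1 x h
      have : 0 ≤ m * (x - x1) := mul_nonneg hm.le (by linarith)
      rw [abs_of_nonneg (by linarith), abs_of_nonneg (by linarith)]
      linarith
    · have g1 := grow x x1 h
      have g2 := hcomp x x1 h
      have : 0 ≤ m * (x1 - x) := mul_nonneg hm.le (by linarith)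
      rw [abs_of_nonpos (by linarith), abs_of_nonpos (by linarith)]
      linarith
  · intro C
    refine ⟨|x1| + 1 + (|C| + 1) / m, by positivity, fun x hx => ?_⟩
    have hb1 : |C| + 1 ≤ |prim b x - k| := by
      have hd : m * ((|C| + 1) / m) = |C| + 1 := by field_simp
      have h1 : (|C| + 1) / m ≤ |x - x1| := by
        have := abs_sub_abs_le_abs_sub x x1
        linarith
      have h2 : m * ((|C| + 1) / m) ≤ m * |x - x1| := mul_le_mul_of_nonneg_left h1 hm.le
      rw [hd] at h2
      refine h2.trans ?_
      rw [← hx1]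
      rcases le_total x1 x with h | h
      · rw [abs_of_nonneg (by linarith : 0 ≤ x - x1)]
        exact (grow x1 x h).trans (le_abs_self _)
      · rw [abs_of_nonpos (by linarith : x - x1 ≤ 0), neg_sub]
        refine (grow x x1 h).trans ?_
        rw [abs_sub_comm]
        exact le_abs_self _
    have h3 := le_abs_self C
    have h4 := abs_nonneg C
    rw [← sq_abs]
    nlinarith
  · intro j
    obtain ⟨H, hH⟩ := (hν k').2.1 j
    have hE : Eig (fun x => prim b x - k') (ν k' j) H := hH
    exact ⟨_, hE.shift c⟩

end BandMono

/-- Main theorem. -/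
theorem band_monotone
    (b : ℝ → ℝ) (m bp bm M : ℝ) (hb : Bfield b m bp bm M) (hmono : Monotone b)
    (ν : ℝ → ℕ → ℝ) (hν : ∀ k, IsEigList b k (ν k)) :
    ∀ n : ℕ, Monotone (fun k => ν k n) := by
  intro n k k' hk
  exact BandMono.band_le b m hb.2.2.1 hb.2.2.2.1 hmono ν hν n hk
end
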